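/- arXiv:math/0703666 — 3 statements merged into one kernel-verified Lean document; each statement's English description precedes it below -/
import Mathlib

section
/- Every braid z in B_n admits a unique decomposition as t_q⁻¹ ... t_1⁻¹ s_1 ... s_p, where (s_1,...,s_p) and (t_1,...,t_q) are normal sequences of simple braids satisfying s_p ≠ 1, t_q ≠ 1, and gcd_L(s_1, t_1) = 1. -/
/-- Relations of the braid group presentation. -/
def braidRels (n : ℕ) : Set (FreeGroup (Fin (n - 1))) :=
  {r | (∃ i j : Fin (n - 1), (i : ℕ) + 2 ≤ (j : ℕ) ∧
          r = FreeGroup.of i * FreeGroup.of j * (FreeGroup.of j * FreeGroup.of i)⁻¹) ∨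
       (∃ i j : Fin (n - 1), (i : ℕ) + 1 = (j : ℕ) ∧
          r = FreeGroup.of i * FreeGroup.of j * FreeGroup.of i *
              (FreeGroup.of j * FreeGroup.of i * FreeGroup.of j)⁻¹)}

/-- Artin's braid group `B_n`. -/
def BraidGroup (n : ℕ) : Type := PresentedGroup (braidRels n)

instance (n : ℕ) : Group (BraidGroup n) :=
  inferInstanceAs (Group (PresentedGroup (braidRels n)))

/-- The Artin generator `σ_{i+1}` (0-indexed `i`). -/
def braidGen {n : ℕ} (i : Fin (n - 1)) : BraidGroup n := PresentedGroup.of i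

/-- The positive braid monoid `B_n^+` (submonoid generated by the `σ_i`). -/
def PosBraid (n : ℕ) : Submonoid (BraidGroup n) :=
  Submonoid.closure (Set.range (braidGen (n := n)))

/-- `x` left-divides `y` (with positive quotient). -/
def DividesL {n : ℕ} (x y : BraidGroup n) : Prop := ∃ z ∈ PosBraid n, y = x * z

/-- `x` right-divides `y` (with positive quotient). -/
def DividesR {n : ℕ} (x y : BraidGroup n) : Prop := ∃ z ∈ PosBraid n, y = z * x

/-- Auxiliary: `deltaAux n m` is the Garside element `Δ_m` viewed inside `B_n`. -/
def deltaAux (n : ℕ) : ℕ → BraidGroup n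
  | 0 => 1
  | m + 1 =>
      ((List.range m).map (fun i =>
        if h : i < n - 1 then braidGen ⟨i, h⟩ else 1)).prod * deltaAux n m

/-- Garside's element `Δ_n = σ_1⋯σ_{n-1} Δ_{n-1}`. -/
def braidDelta (n : ℕ) : BraidGroup n := deltaAux n n

/-- A simple braid: a (positive) divisor of `Δ_n`. -/
def Simple {n : ℕ} (s : BraidGroup n) : Prop :=
  s ∈ PosBraid n ∧ DividesL s (braidDelta n)

/-- Normality of a pair, in the divisor form: every `σ_i` left-dividing `t`
right-divides `s`. -/
def NormalPair {n : ℕ} (s t : BraidGroup n) : Prop :=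
  ∀ i : Fin (n - 1), DividesL (braidGen i) t → DividesR (braidGen i) s

/-- `g` is the left gcd of `x` and `y` in `B_n^+`. -/
def IsLeftGcd {n : ℕ} (g x y : BraidGroup n) : Prop :=
  g ∈ PosBraid n ∧ DividesL g x ∧ DividesL g y ∧
    ∀ d ∈ PosBraid n, DividesL d x → DividesL d y → DividesL d g

/-- Normality of a pair, in the gcd form: `s = gcd_L(st, Δ_n)`. -/
def GNormal {n : ℕ} (s t : BraidGroup n) : Prop :=
  IsLeftGcd s (s * t) (braidDelta n)

/-- `u` is the left lcm of `x` and `y`. -/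
def IsLeftLcm {n : ℕ} (u x y : BraidGroup n) : Prop :=
  DividesR x u ∧ DividesR y u ∧ ∀ v, DividesR x v → DividesR y v → DividesR u v

/-- The position `i` inside `Fin n`. -/
def finL {n : ℕ} (i : Fin (n - 1)) : Fin n := ⟨i, by have := i.isLt; omega⟩

/-- The position `i + 1` inside `Fin n`. -/
def finR {n : ℕ} (i : Fin (n - 1)) : Fin n := ⟨(i : ℕ) + 1, by have := i.isLt; omega⟩

/-- `i` is a descent of the permutation `f` : `f(i) > f(i+1)`. -/
def Descent {n : ℕ} (f : Equiv.Perm (Fin n)) (i : Fin (n - 1)) : Prop :=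
  f (finR i) < f (finL i)

/-- `i` is a recoil of the permutation `f` : `f⁻¹(i) > f⁻¹(i+1)`. -/
def Recoil {n : ℕ} (f : Equiv.Perm (Fin n)) (i : Fin (n - 1)) : Prop :=
  f⁻¹ (finR i) < f⁻¹ (finL i)

/-- Braid words: letters are a generator index together with a sign
(`true` = positive letter `σ_i`, `false` = negative letter `σ_i⁻¹`). -/
abbrev BWord (n : ℕ) := List (Fin (n - 1) × Bool)

/-- The braid represented by a braid word. -/
def evalWord {n : ℕ} (w : BWord n) : BraidGroup n :=
  (w.map (fun x => if x.2 then braidGen x.1 else (braidGen x.1)⁻¹)).prod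


namespace BN

open FreeMonoid in
/-- Braid relations on the free monoid. -/
def brel (N : ℕ) : FreeMonoid (Fin N) → FreeMonoid (Fin N) → Prop := fun u v =>
  (∃ i j : Fin N, (i : ℕ) + 2 ≤ (j : ℕ) ∧ u = of i * of j ∧ v = of j * of i) ∨
  (∃ i j : Fin N, (i : ℕ) + 1 = (j : ℕ) ∧ u = of i * of j * of i ∧ v = of j * of i * of j)

/-- The abstract positive braid monoid. -/
abbrev BM (N : ℕ) := PresentedMonoid (brel N)

/-- generators -/
def sg {N : ℕ} (i : Fin N) : BM N := PresentedMonoid.of (brel N) i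

def Far {N : ℕ} (i j : Fin N) : Prop := (i : ℕ) + 2 ≤ (j : ℕ) ∨ (j : ℕ) + 2 ≤ (i : ℕ)
def Adj {N : ℕ} (i j : Fin N) : Prop := (i : ℕ) + 1 = (j : ℕ) ∨ (j : ℕ) + 1 = (i : ℕ)

theorem Far.symm {N : ℕ} {i j : Fin N} (h : Far i j) : Far j i := Or.symm h
theorem Adj.symm {N : ℕ} {i j : Fin N} (h : Adj i j) : Adj j i := Or.symm h

theorem tri {N : ℕ} (i j : Fin N) : i = j ∨ Far i j ∨ Adj i j := by
  unfold Far Adj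
  rw [Fin.ext_iff]
  omega

theorem sg_rel2 {N : ℕ} {i j : Fin N} (h : (i : ℕ) + 2 ≤ (j : ℕ)) :
    sg i * sg j = sg j * sg i :=
  PresentedMonoid.mk_eq_mk_of_rel (rels := brel N) (Or.inl ⟨i, j, h, rfl, rfl⟩)

theorem sg_rel3 {N : ℕ} {i j : Fin N} (h : (i : ℕ) + 1 = (j : ℕ)) :
    sg i * sg j * sg i = sg j * sg i * sg j :=
  PresentedMonoid.mk_eq_mk_of_rel (rels := brel N) (Or.inr ⟨i, j, h, rfl, rfl⟩)

theorem far_comm {N : ℕ} {i j : Fin N} (h : Far i j) (x : BM N) :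
    sg i * (sg j * x) = sg j * (sg i * x) := by
  rcases h with h | h
  · rw [← mul_assoc, sg_rel2 h, mul_assoc]
  · rw [← mul_assoc, ← sg_rel2 h, mul_assoc]

theorem adj_braid {N : ℕ} {i j : Fin N} (h : Adj i j) (x : BM N) :
    sg i * (sg j * (sg i * x)) = sg j * (sg i * (sg j * x)) := by
  rcases h with h | h
  · have := sg_rel3 h
    simp only [← mul_assoc, this]
  · have := sg_rel3 h
    simp only [← mul_assoc, ← this]

/-- length -/
def lenHom (N : ℕ) : BM N →* Multiplicative ℕ :=
  PresentedMonoid.lift (fun _ => Multiplicative.ofAdd 1) (by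
    rintro a b (⟨i, j, _, rfl, rfl⟩ | ⟨i, j, _, rfl, rfl⟩) <;> simp)

def len {N : ℕ} (x : BM N) : ℕ := Multiplicative.toAdd (lenHom N x)

@[simp] theorem len_mul {N : ℕ} (x y : BM N) : len (x * y) = len x + len y := by
  simp [len]
@[simp] theorem len_one {N : ℕ} : len (1 : BM N) = 0 := by
  simp [len]
@[simp] theorem len_sg {N : ℕ} (i : Fin N) : len (sg i) = 1 := by
  simp [len, lenHom, sg]

theorem BM.ind {N : ℕ} {p : BM N → Prop} (h1 : p 1) (h2 : ∀ i x, p x → p (sg i * x)) (x : BM N) :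
    p x := by
  refine PresentedMonoid.inductionOn (δ := p) x fun a => ?_
  induction a using FreeMonoid.recOn with
  | one => exact h1
  | of_mul i x hx => exact h2 i _ hx

theorem BM.cases {N : ℕ} (x : BM N) : x = 1 ∨ ∃ i y, x = sg i * y := by
  refine BM.ind (p := fun x => x = 1 ∨ ∃ i y, x = sg i * y) (Or.inl rfl) ?_ x
  intro i x _
  exact Or.inr ⟨i, x, rfl⟩

theorem len_eq_zero {N : ℕ} {x : BM N} (h : len x = 0) : x = 1 := by
  rcases BM.cases x with h | ⟨i, y, rfl⟩
  · exact h
  · simp at h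

/-- Garside relation -/
def RR {N : ℕ} (i : Fin N) (x : BM N) (j : Fin N) (y : BM N) : Prop :=
  (i = j ∧ x = y) ∨ (Far i j ∧ ∃ z, x = sg j * z ∧ y = sg i * z) ∨
  (Adj i j ∧ ∃ z, x = sg j * (sg i * z) ∧ y = sg i * (sg j * z))

theorem RR.symm {N : ℕ} {i : Fin N} {x : BM N} {j : Fin N} {y : BM N} (h : RR i x j y) :
    RR j y i x := by
  rcases h with ⟨rfl, rfl⟩ | ⟨h, z, rfl, rfl⟩ | ⟨h, z, rfl, rfl⟩
  · exact Or.inl ⟨rfl, rfl⟩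
  · exact Or.inr (Or.inl ⟨h.symm, z, rfl, rfl⟩)
  · exact Or.inr (Or.inr ⟨h.symm, z, rfl, rfl⟩)

theorem RR.len_eq {N : ℕ} {i : Fin N} {x : BM N} {j : Fin N} {y : BM N} (h : RR i x j y) :
    len x = len y := by
  rcases h with ⟨rfl, rfl⟩ | ⟨h, z, rfl, rfl⟩ | ⟨h, z, rfl, rfl⟩ <;> simp

theorem RR.eq {N : ℕ} {i : Fin N} {x : BM N} {j : Fin N} {y : BM N} (h : RR i x j y) :
    sg i * x = sg j * y := by
  rcases h with ⟨rfl, rfl⟩ | ⟨h, z, rfl, rfl⟩ | ⟨h, z, rfl, rfl⟩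
  · rfl
  · exact far_comm h z
  · exact adj_braid h z

/-- The Garside property up to length `L`. -/
def KK (N L : ℕ) : Prop := ∀ (i j : Fin N) (x y : BM N), len x < L → sg i * x = sg j * y → RR i x j y

theorem not_far_self {N : ℕ} {i : Fin N} : ¬ Far i i := by unfold Far; omega
theorem not_adj_self {N : ℕ} {i : Fin N} : ¬ Adj i i := by unfold Adj; omega
theorem not_adj_of_far {N : ℕ} {i j : Fin N} (h : Far i j) : ¬ Adj i j := by
  unfold Far at h; unfold Adj; omega

theorem KK.cancel {N L : ℕ} (h : KK N L) {i : Fin N} {x y : BM N} (hl : len x < L)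
    (e : sg i * x = sg i * y) : x = y := by
  rcases h i i x y hl e with ⟨_, h⟩ | ⟨h, _⟩ | ⟨h, _⟩
  · exact h
  · exact absurd h not_far_self
  · exact absurd h not_adj_self

theorem KK.far {N L : ℕ} (h : KK N L) {i j : Fin N} (hf : Far i j) {x y : BM N} (hl : len x < L)
    (e : sg i * x = sg j * y) : ∃ z, x = sg j * z ∧ y = sg i * z := by
  rcases h i j x y hl e with ⟨rfl, h⟩ | ⟨_, h⟩ | ⟨h, _⟩
  · exact absurd hf not_far_self
  · exact h
  · exact absurd h (not_adj_of_far hf)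

theorem KK.adj {N L : ℕ} (h : KK N L) {i j : Fin N} (hf : Adj i j) {x y : BM N} (hl : len x < L)
    (e : sg i * x = sg j * y) : ∃ z, x = sg j * (sg i * z) ∧ y = sg i * (sg j * z) := by
  rcases h i j x y hl e with ⟨rfl, h⟩ | ⟨h, _⟩ | ⟨_, h⟩
  · exact absurd hf not_adj_self
  · exact absurd hf (not_adj_of_far h)
  · exact h

theorem tri_aux1 {N : ℕ} {i j k : Fin N} (a : Adj i j) (b : Adj j k) (h : ¬ i = k) : Far i k := by
  unfold Adj at *; unfold Far; rw [Fin.ext_iff] at h; omega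

/-- case 2: ij adjacent, jk far, ik far -/
theorem RR.trans_c2 {N : ℕ} {i j k : Fin N} (a : Adj i j) (b : Far j k) (c : Far i k) {z z' : BM N}
    (K : KK N (len (sg k * z')))
    (e : sg i * (sg j * z) = sg k * z') : RR i (sg j * (sg i * z)) k (sg j * z') := by
  have hl := congrArg len e
  simp at hl
  obtain ⟨u, h1, rfl⟩ := K.far c (by simp; omega) e
  simp at hl
  obtain ⟨v, rfl, rfl⟩ := K.far b (by simp; omega) h1
  refine Or.inr (Or.inl ⟨c, sg j * (sg i * v), ?_, ?_⟩)
  · rw [far_comm c, far_comm b]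
  · rw [adj_braid a.symm]

/-- case b: ij adj, jk far, ik adj -/
theorem RR.trans_cb {N : ℕ} {i j k : Fin N} (a : Adj i j) (b : Far j k) (c : Adj i k) {z z' : BM N}
    (K : KK N (len (sg k * z')))
    (e : sg i * (sg j * z) = sg k * z') : RR i (sg j * (sg i * z)) k (sg j * z') := by
  have hl := congrArg len e
  simp at hl
  obtain ⟨u, h1, rfl⟩ := K.adj c (by simp; omega) e
  simp at hl
  obtain ⟨v, rfl, h2⟩ := K.far b (by simp; omega) h1
  simp at hl
  obtain ⟨s, rfl, rfl⟩ := K.adj a (by simp; omega) h2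
  refine Or.inr (Or.inr ⟨c, sg j * (sg i * (sg k * s)), ?_, ?_⟩)
  · rw [adj_braid c, far_comm b, far_comm b.symm s, adj_braid a.symm]
  · rw [far_comm b.symm (sg i * s), adj_braid a.symm, adj_braid c, far_comm b]

theorem RR.trans {N L : ℕ} (K : KK N L) {i j k : Fin N} {x y w : BM N} (hL : len y ≤ L)
    (h1 : RR i x j y) (h2 : RR j y k w) : RR i x k w := by
  have h1' := h1
  have h2' := h2
  have K : KK N (len y) := fun i j x y hl e => K i j x y (lt_of_lt_of_le hl hL) e
  rcases h1 with ⟨rfl, rfl⟩ | ⟨a, z, rfl, rfl⟩ | ⟨a, z, rfl, rfl⟩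
  · exact h2
  · rcases h2 with ⟨rfl, rfl⟩ | ⟨b, z', e, rfl⟩ | ⟨b, z', e, rfl⟩
    · exact h1'
    · have hl := congrArg len e
      simp at hl
      rcases tri i k with rfl | c | c
      · have := K.cancel (by simp) e
        subst this
        exact Or.inl ⟨rfl, rfl⟩
      · obtain ⟨u, rfl, rfl⟩ := K.far c (by simp) e
        refine Or.inr (Or.inl ⟨c, sg j * u, ?_, ?_⟩)
        · rw [far_comm b]
        · rw [far_comm a]
      · obtain ⟨u, rfl, rfl⟩ := K.adj c (by simp) e
        refine Or.inr (Or.inr ⟨c, sg j * u, ?_, ?_⟩)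
        · rw [far_comm b, far_comm a]
        · rw [far_comm a.symm, far_comm b]
    · rcases tri i k with rfl | c | c
      · exact absurd b.symm (not_adj_of_far a)
      · exact (RR.trans_c2 b.symm a.symm c.symm K e.symm).symm
      · exact (RR.trans_cb b.symm a.symm c.symm K e.symm).symm
  · rcases h2 with ⟨rfl, rfl⟩ | ⟨b, z', e, rfl⟩ | ⟨b, z', e, rfl⟩
    · exact h1'
    · rcases tri i k with rfl | c | c
      · exact absurd a.symm (not_adj_of_far b)
      · exact RR.trans_c2 a b c (by rwa [e] at K) e
      · exact RR.trans_cb a b c (by rwa [e] at K) e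
    · have hl := congrArg len e
      simp at hl
      by_cases hik : i = k
      · subst hik
        have := K.cancel (by simp; omega) (K.cancel (by simp) e)
        subst this
        exact Or.inl ⟨rfl, rfl⟩
      · have c := tri_aux1 a b hik
        obtain ⟨u, e1, e2⟩ := K.far c (by simp) e
        have hl1 := congrArg len e1
        simp at hl1
        obtain ⟨v, rfl, rfl⟩ := K.adj b (by simp; omega) e1
        simp at hl hl1
        obtain ⟨v', rfl, e3⟩ := K.adj a.symm (by simp; omega) e2
        have e4 := K.cancel (by simp; omega) e3
        obtain ⟨t, rfl, rfl⟩ := K.far c.symm (by simp; omega) e4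
        refine Or.inr (Or.inl ⟨c, sg j * (sg k * (sg i * (sg j * t))), ?_, ?_⟩)
        · rw [adj_braid b.symm, far_comm c, adj_braid a]
        · rw [far_comm c.symm (sg j * t), adj_braid a, far_comm c.symm, adj_braid b.symm]

theorem fm_cases {α : Type*} (w : FreeMonoid α) : w = 1 ∨ ∃ i y, w = FreeMonoid.of i * y := by
  induction w using FreeMonoid.recOn with
  | one => exact Or.inl rfl
  | of_mul i x hx => exact Or.inr ⟨i, x, rfl⟩

theorem fm_inj {α : Type*} {i j : α} {x y : FreeMonoid α}
    (h : FreeMonoid.of i * x = FreeMonoid.of j * y) : i = j ∧ x = y := by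
  have h' : (i :: FreeMonoid.toList x) = j :: FreeMonoid.toList y := congrArg FreeMonoid.toList h
  injection h' with h1 h2
  exact ⟨h1, FreeMonoid.toList.injective h2⟩

theorem mk_of_mul {N : ℕ} (i : Fin N) (x : FreeMonoid (Fin N)) :
    PresentedMonoid.mk (brel N) (FreeMonoid.of i * x) = sg i * PresentedMonoid.mk (brel N) x := by
  rw [map_mul]; rfl

theorem lenmk {N : ℕ} (u : FreeMonoid (Fin N)) :
    len (PresentedMonoid.mk (brel N) u) = u.length := by
  induction u using FreeMonoid.recOn with
  | one => simp
  | of_mul i x hx =>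
    rw [mk_of_mul, len_mul, hx, FreeMonoid.length_mul, FreeMonoid.length_of, len_sg]

theorem rel_len {N : ℕ} {u v : FreeMonoid (Fin N)} (h : ConGen.Rel (brel N) u v) :
    u.length = v.length := by
  have := congrArg len (PresentedMonoid.mk_eq_mk_iff.2 h)
  rwa [lenmk, lenmk] at this

theorem rel_RR {N L : ℕ} (K : KK N L) {u v : FreeMonoid (Fin N)} (h : ConGen.Rel (brel N) u v) :
    u.length ≤ L + 1 → ∀ i u' j v', u = FreeMonoid.of i * u' → v = FreeMonoid.of j * v' →
      RR i (PresentedMonoid.mk (brel N) u') j (PresentedMonoid.mk (brel N) v') := by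
  induction h with
  | of x y h =>
    rintro - i u' j v' rfl rfl
    rcases h with ⟨a, b, h, e1, e2⟩ | ⟨a, b, h, e1, e2⟩
    · obtain ⟨rfl, rfl⟩ := fm_inj e1
      obtain ⟨rfl, rfl⟩ := fm_inj e2
      exact Or.inr (Or.inl ⟨Or.inl h, 1, by rw [mul_one]; rfl, by rw [mul_one]; rfl⟩)
    · rw [mul_assoc] at e1 e2
      obtain ⟨rfl, rfl⟩ := fm_inj e1
      obtain ⟨rfl, rfl⟩ := fm_inj e2
      exact Or.inr (Or.inr ⟨Or.inl h, 1, by rw [mul_one, mk_of_mul]; rfl,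
        by rw [mul_one, mk_of_mul]; rfl⟩)
  | refl x =>
    rintro - i u' j v' rfl e2
    obtain ⟨rfl, rfl⟩ := fm_inj e2
    exact Or.inl ⟨rfl, rfl⟩
  | symm h ih =>
    intro hl i u' j v' e1 e2
    exact (ih (by rwa [rel_len h]) j v' i u' e2 e1).symm
  | @trans x y z h1 h2 ih1 ih2 =>
    intro hl i u' j v' e1 e2
    have l1 := rel_len h1
    rcases fm_cases y with rfl | ⟨k, w, rfl⟩
    · rw [e1] at l1
      simp at l1
    · have r1 := ih1 hl i u' k w e1 rfl
      have r2 := ih2 (by omega) k w j v' rfl e2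
      refine RR.trans K ?_ r1 r2
      rw [lenmk]
      simp at l1
      omega
  | @mul w x y z h1 h2 ih1 ih2 =>
    intro hl i u' j v' e1 e2
    have l1 := rel_len h1
    rcases fm_cases w with rfl | ⟨k, w, rfl⟩
    · rcases fm_cases x with rfl | ⟨k', x, rfl⟩
      · rw [one_mul] at *
        exact ih2 hl i u' j v' e1 e2
      · simp at l1
        omega
    · rcases fm_cases x with rfl | ⟨k', x, rfl⟩
      · simp at l1
      · rw [mul_assoc] at e1 e2
        obtain ⟨rfl, rfl⟩ := fm_inj e1
        obtain ⟨rfl, rfl⟩ := fm_inj e2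
        have hy : PresentedMonoid.mk (brel N) y = PresentedMonoid.mk (brel N) z :=
          PresentedMonoid.mk_eq_mk_iff.2 h2
        have r := ih1 (by simp at hl ⊢; omega) _ _ _ _ rfl rfl
        rw [map_mul, map_mul, hy]
        rcases r with ⟨h, e⟩ | ⟨h, q, e, e'⟩ | ⟨h, q, e, e'⟩
        · exact Or.inl ⟨h, by rw [e]⟩
        · exact Or.inr (Or.inl ⟨h, q * PresentedMonoid.mk (brel N) z,
            by rw [e, mul_assoc], by rw [e', mul_assoc]⟩)
        · exact Or.inr (Or.inr ⟨h, q * PresentedMonoid.mk (brel N) z,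
            by rw [e, mul_assoc, mul_assoc], by rw [e', mul_assoc, mul_assoc]⟩)

theorem KK_all (N L : ℕ) : KK N L := by
  induction L with
  | zero => intro i j x y h; omega
  | succ L ih =>
    intro i j x y hl e
    obtain ⟨u, rfl⟩ := PresentedMonoid.surjective_mk x
    obtain ⟨v, rfl⟩ := PresentedMonoid.surjective_mk y
    rw [← mk_of_mul, ← mk_of_mul] at e
    refine rel_RR ih (PresentedMonoid.mk_eq_mk_iff.1 e) ?_ i u j v rfl rfl
    rw [lenmk] at hl
    simp
    omega

/-- Garside's key lemma. -/
theorem garside {N : ℕ} {i j : Fin N} {x y : BM N} (e : sg i * x = sg j * y) : RR i x j y :=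
  KK_all N (len x + 1) i j x y (by omega) e

theorem left_cancel {N : ℕ} {a x y : BM N} (e : a * x = a * y) : x = y := by
  induction a using BM.ind with
  | h1 => simpa using e
  | h2 i a ih =>
    rw [mul_assoc, mul_assoc] at e
    exact ih ((KK_all N (len (a * x) + 1)).cancel (by omega) e)

/-- reversal -/
def revHom (N : ℕ) : BM N →* (BM N)ᵐᵒᵖ :=
  PresentedMonoid.lift (fun i => MulOpposite.op (sg i)) (by
    rintro a b (⟨i, j, h, rfl, rfl⟩ | ⟨i, j, h, rfl, rfl⟩)
    · simp only [map_mul, FreeMonoid.lift_eval_of, ← MulOpposite.op_mul, sg_rel2 h]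
    · simp only [map_mul, FreeMonoid.lift_eval_of, ← MulOpposite.op_mul, ← mul_assoc, sg_rel3 h])

def rev {N : ℕ} (x : BM N) : BM N := (revHom N x).unop

theorem rev_mul {N : ℕ} (x y : BM N) : rev (x * y) = rev y * rev x := by
  simp [rev]
@[simp] theorem rev_one {N : ℕ} : rev (1 : BM N) = 1 := by
  simp [rev]
@[simp] theorem rev_sg {N : ℕ} (i : Fin N) : rev (sg i) = sg i := by
  simp [rev, revHom, sg]
@[simp] theorem rev_rev {N : ℕ} (x : BM N) : rev (rev x) = x := by
  induction x using BM.ind with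
  | h1 => simp
  | h2 i x ih => rw [rev_mul, rev_mul, ih, rev_sg, rev_sg]

theorem right_cancel {N : ℕ} {a x y : BM N} (e : x * a = y * a) : x = y := by
  have := congrArg rev e
  rw [rev_mul, rev_mul] at this
  rw [← rev_rev x, left_cancel this, rev_rev]

/-- Right lcm. -/
theorem lcm_exists {N : ℕ} (L : ℕ) : ∀ (c d e : BM N), len c ≤ L → d ∣ c → e ∣ c →
    ∃ m, d ∣ m ∧ e ∣ m ∧ ∀ m', d ∣ m' → e ∣ m' → m ∣ m' := by
  induction L with
  | zero =>
    rintro c d e hl ⟨a, rfl⟩ ⟨b, h⟩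
    have h' := congrArg len h
    simp at hl h'
    have h1 : d = 1 := len_eq_zero (by omega)
    have h2 : e = 1 := len_eq_zero (by omega)
    subst h1; subst h2
    exact ⟨1, dvd_rfl, dvd_rfl, fun _ h _ => h⟩
  | succ L ih =>
    intro c d e hl hd he
    rcases BM.cases d with rfl | ⟨i, d, rfl⟩
    · exact ⟨e, one_dvd _, dvd_rfl, fun _ _ h => h⟩
    rcases BM.cases e with rfl | ⟨j, e, rfl⟩
    · exact ⟨sg i * d, dvd_rfl, one_dvd _, fun _ h _ => h⟩
    -- complement
    obtain ⟨p, q, hpq, hK⟩ : ∃ p q : BM N, sg i * p = sg j * q ∧ ∀ x y, sg i * x = sg j * y →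
        ∃ z, x = p * z ∧ y = q * z := by
      rcases tri i j with rfl | h | h
      · exact ⟨1, 1, rfl, fun x y e => ⟨x, by simp, by simpa using (left_cancel e).symm⟩⟩
      · refine ⟨sg j, sg i, by simpa using far_comm h 1, fun x y e => ?_⟩
        exact (KK_all N (len x + 1)).far h (by omega) e
      · refine ⟨sg j * sg i, sg i * sg j, by simpa using adj_braid h 1, fun x y e => ?_⟩
        simpa only [mul_assoc] using (KK_all N (len x + 1)).adj h (by omega) e
    obtain ⟨a, rfl⟩ := hd
    obtain ⟨b, hb⟩ := he
    rw [mul_assoc, mul_assoc] at hb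
    obtain ⟨z, hz1, hz2⟩ := hK _ _ hb
    have hlb := congrArg len hb
    simp at hl hlb
    obtain ⟨f, ⟨g, hf1⟩, ⟨h, hf2⟩, hf⟩ := ih (d * a) d p (by simp; omega) ⟨a, rfl⟩ ⟨z, hz1⟩
    have key : sg i * f = sg j * (q * h) := by
      rw [hf2, ← mul_assoc, hpq, mul_assoc]
    obtain ⟨r, hr⟩ := hf _ (Dvd.intro _ rfl) ⟨z, hz1⟩
    have h2 : e * b = q * h * r := by
      apply left_cancel (a := sg j)
      rw [← hb, hr, ← mul_assoc, key]
      simp only [mul_assoc]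
    obtain ⟨f', ⟨g', hf1'⟩, ⟨h', hf2'⟩, hf'⟩ := ih (e * b) e (q * h) (by simp; omega) ⟨b, rfl⟩ ⟨r, h2⟩
    refine ⟨sg j * f', ?_, ?_, ?_⟩
    · rw [hf2', ← mul_assoc, ← key, hf1]
      exact ⟨g * h', by simp only [mul_assoc]⟩
    · rw [hf1']
      exact ⟨g', by simp only [mul_assoc]⟩
    · rintro m ⟨x, rfl⟩ ⟨y, hy⟩
      rw [mul_assoc, mul_assoc] at hy
      obtain ⟨w, hw1, hw2⟩ := hK _ _ hy
      obtain ⟨r', hr'⟩ := hf (d * x) ⟨x, rfl⟩ ⟨w, hw1⟩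
      have h3 : e * y = q * h * r' := by
        apply left_cancel (a := sg j)
        rw [← hy, hr', ← mul_assoc, key]
        simp only [mul_assoc]
      obtain ⟨v, hv⟩ := hf' (e * y) ⟨y, rfl⟩ ⟨r', h3⟩
      exact ⟨v, by rw [mul_assoc, hy, hv, mul_assoc]⟩

theorem gcd_exists {N : ℕ} (x y : BM N) :
    ∃ g, g ∣ x ∧ g ∣ y ∧ ∀ d, d ∣ x → d ∣ y → d ∣ g := by
  classical
  have hb : ∀ d : BM N, d ∣ x → len d ≤ len x := by
    rintro d ⟨a, rfl⟩; simp
  obtain ⟨g, ⟨hg1, hg2⟩, hmax⟩ : ∃ g, (g ∣ x ∧ g ∣ y) ∧ ∀ d, d ∣ x → d ∣ y → len d ≤ len g := by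
    by_contra hcon
    push Not at hcon
    have : ∀ k : ℕ, ∃ g : BM N, (g ∣ x ∧ g ∣ y) ∧ k ≤ len g := by
      intro k
      induction k with
      | zero => exact ⟨1, ⟨one_dvd _, one_dvd _⟩, by simp⟩
      | succ k ih =>
        obtain ⟨g, hg, hk⟩ := ih
        obtain ⟨d, h1, h2, h3⟩ := hcon g hg
        exact ⟨d, ⟨h1, h2⟩, by omega⟩
    obtain ⟨g, hg, hk⟩ := this (len x + 1)
    have := hb g hg.1
    omega
  refine ⟨g, hg1, hg2, fun d h1 h2 => ?_⟩
  obtain ⟨m, hm1, ⟨q, hq⟩, hm⟩ := lcm_exists (len x) x d g le_rfl h1 hg1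
  have := hmax m (hm x h1 hg1) (hm y h2 hg2)
  rw [hq, len_mul] at this
  have hq1 : q = 1 := len_eq_zero (by omega)
  rw [hq1, mul_one] at hq
  rw [← hq]
  exact hm1

end BN

namespace BN

section Delta
variable {M : Type*} [Monoid M]

def cc (s : ℕ → M) (m : ℕ) : M := ((List.range m).map s).prod
def cd (s : ℕ → M) : ℕ → M
  | 0 => 1
  | m + 1 => s m * cd s m
def DD (s : ℕ → M) : ℕ → M
  | 0 => 1
  | m + 1 => cc s m * DD s m

theorem cc_succ (s : ℕ → M) (m : ℕ) : cc s (m + 1) = cc s m * s m := by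
  simp [cc, List.range_succ]

/-- braid relations up to index `N` -/
structure BR (s : ℕ → M) (N : ℕ) : Prop where
  far : ∀ i j, i + 2 ≤ j → Commute (s i) (s j)
  adj : ∀ i, i + 1 < N → s i * s (i + 1) * s i = s (i + 1) * s i * s (i + 1)

variable {s : ℕ → M} {N : ℕ}

theorem cc_comm (h : BR s N) (m j : ℕ) (hj : m + 1 ≤ j) : Commute (cc s m) (s j) := by
  induction m with
  | zero => simp [cc]
  | succ m ih =>
    rw [cc_succ]
    exact (ih (by omega)).mul_left (h.far _ _ (by omega))

theorem cd_comm (h : BR s N) (m j : ℕ) (hj : m + 1 ≤ j) : Commute (cd s m) (s j) := by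
  induction m with
  | zero => simp [cd]
  | succ m ih =>
    exact (h.far _ _ (by omega)).mul_left (ih (by omega))

theorem DD_comm (h : BR s N) (m j : ℕ) (hj : m ≤ j) : Commute (DD s m) (s j) := by
  induction m with
  | zero => simp [DD]
  | succ m ih =>
    exact (cc_comm h _ _ (by omega)).mul_left (ih (by omega))

theorem cc_shift (h : BR s N) (m i : ℕ) (hi : i + 1 < m) (hm : m ≤ N) :
    cc s m * s i = s (i + 1) * cc s m := by
  induction m with
  | zero => omega
  | succ m ih =>
    rcases Nat.lt_or_ge (i + 1) m with h1 | h1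
    · rw [cc_succ, mul_assoc, ← (h.far i m (by omega)).eq, ← mul_assoc, ih h1 (by omega), mul_assoc]
    · obtain rfl : m = i + 1 := by omega
      rw [cc_succ, cc_succ, mul_assoc (cc s i), mul_assoc (cc s i), h.adj i (by omega),
        mul_assoc (s (i + 1)), ← mul_assoc (cc s i), (cc_comm h i (i + 1) le_rfl).eq, mul_assoc]

theorem cd_shift (h : BR s N) (m i : ℕ) (hi : i + 1 < m) (hm : m ≤ N) :
    s i * cd s m = cd s m * s (i + 1) := by
  induction m with
  | zero => omega
  | succ m ih =>
    rcases Nat.lt_or_ge (i + 1) m with h1 | h1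
    · rw [cd, ← mul_assoc, (h.far i m (by omega)).eq, mul_assoc, ih h1 (by omega), mul_assoc]
    · obtain rfl : m = i + 1 := by omega
      rw [cd, cd, ← mul_assoc, ← mul_assoc, h.adj i (by omega), mul_assoc _ _ (cd s i),
        ← (cd_comm h i (i + 1) le_rfl).eq]
      simp only [mul_assoc]

theorem DD_succ' (h : BR s N) (m : ℕ) : DD s (m + 1) = DD s m * cd s m := by
  induction m with
  | zero => simp [DD, cc, cd]
  | succ m ih =>
    rw [DD, ih, cc_succ, mul_assoc, ← mul_assoc (s m), ← (DD_comm h m m le_rfl).eq, mul_assoc,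
      ← mul_assoc, ← ih, DD, cd]

theorem DD_shift (h : BR s N) (m i : ℕ) (hi : i + 2 ≤ m) (hm : m ≤ N + 1) :
    DD s m * s i = s (m - 2 - i) * DD s m := by
  induction m generalizing i with
  | zero => omega
  | succ m ih =>
    rcases Nat.lt_or_ge (i + 1) m with h1 | h1
    · rw [DD, mul_assoc, ih i (by omega) (by omega), ← mul_assoc, cc_shift h _ _ (by omega) (by omega),
        mul_assoc]
      congr 2
      omega
    · obtain rfl : m = i + 1 := by omega
      have e0 : i + 1 + 1 - 2 - i = 0 := by omega
      rw [e0]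
      rcases i with _ | i
      · simp [DD, cc]
      · have := ih 0 (by omega) (by omega)
        have e1 : i + 1 + 1 - 2 - 0 = i := by omega
        rw [e1] at this
        have := ih i (by omega) (by omega)
        have e1 : i + 1 + 1 - 2 - i = 0 := by omega
        rw [e1] at this
        rw [DD_succ' h, ← mul_assoc, ← this, mul_assoc, mul_assoc, cd_shift h _ _ (by omega) (by omega)]

theorem cd_end (m : ℕ) : ∃ q, cd s (m + 1) = q * s 0 := by
  induction m with
  | zero => exact ⟨1, by simp [cd]⟩
  | succ m ih =>
    obtain ⟨q, hq⟩ := ih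
    exact ⟨s (m + 1) * q, by rw [cd, hq, mul_assoc]⟩

theorem dvd_DD (h : BR s N) (rc : ∀ a x y : M, x * a = y * a → x = y) (m i : ℕ) (hi : i + 2 ≤ m)
    (hm : m ≤ N + 1) : s i ∣ DD s m := by
  induction m with
  | zero => omega
  | succ m ih =>
    rcases Nat.lt_or_ge (i + 1) m with h1 | h1
    · rw [DD_succ' h]
      exact Dvd.dvd.mul_right (ih (by omega) (by omega)) _
    · obtain rfl : m = i + 1 := by omega
      have h1 := DD_shift h (i + 2) 0 (by omega) hm
      have e : i + 2 - 2 - 0 = i := by omega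
      rw [e] at h1
      obtain ⟨q, hq⟩ := cd_end (s := s) i
      have h2 := DD_succ' h (i + 1)
      rw [hq, ← mul_assoc] at h2
      refine ⟨DD s (i + 1) * q, rc (s 0) _ _ ?_⟩
      rw [h1, h2, mul_assoc, mul_assoc, mul_assoc]

end Delta

/-- generators indexed by naturals -/
def sn (N : ℕ) (i : ℕ) : BM N := if h : i < N then sg ⟨i, h⟩ else 1

theorem sn_fin {N : ℕ} (i : Fin N) : sn N i = sg i := by simp [sn]

theorem sn_BR (N : ℕ) : BR (sn N) N where
  far i j h := by
    unfold sn
    split_ifs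
    · exact sg_rel2 h
    all_goals simp
  adj i h := by
    have h' : i < N := by omega
    simp only [sn, h, h', dif_pos]
    exact sg_rel3 rfl

def Dm (N : ℕ) : BM N := DD (sn N) (N + 1)

theorem Dm_shift {N : ℕ} (i : Fin N) : ∃ j, sg i * Dm N = Dm N * sg j := by
  have hi := i.2
  refine ⟨⟨N - 1 - i, by omega⟩, ?_⟩
  rw [← sn_fin, ← sn_fin, Dm, DD_shift (sn_BR N) _ _ (by simp; omega) le_rfl]
  congr 2
  simp
  omega

theorem dvd_Dm {N : ℕ} (i : Fin N) : sg i ∣ Dm N := by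
  rw [← sn_fin]
  exact dvd_DD (sn_BR N) (fun _ _ _ => right_cancel) _ _ (by omega) le_rfl

theorem Dm_pow_shift {N : ℕ} (k : ℕ) (i : Fin N) : ∃ j, sg i * Dm N ^ k = Dm N ^ k * sg j := by
  induction k generalizing i with
  | zero => exact ⟨i, by simp⟩
  | succ k ih =>
    obtain ⟨j, hj⟩ := ih i
    obtain ⟨j', hj'⟩ := Dm_shift j
    exact ⟨j', by rw [pow_succ, ← mul_assoc, hj, mul_assoc, hj', mul_assoc]⟩

theorem dvd_Dm_pow {N : ℕ} (x : BM N) : ∃ k, x ∣ Dm N ^ k := by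
  induction x using BM.ind with
  | h1 => exact ⟨0, one_dvd _⟩
  | h2 i x ih =>
    obtain ⟨k, y, hy⟩ := ih
    obtain ⟨j, hj⟩ := Dm_pow_shift k i
    obtain ⟨q, hq⟩ := dvd_Dm j
    exact ⟨k + 1, y * q, by
      calc Dm N ^ (k + 1) = Dm N ^ k * (sg j * q) := by rw [pow_succ, ← hq]
        _ = sg i * x * (y * q) := by rw [← mul_assoc, ← hj, hy]; simp only [mul_assoc]⟩

theorem common_mult {N : ℕ} (x y : BM N) : ∃ a b, x * a = y * b := by
  obtain ⟨k, a, ha⟩ := dvd_Dm_pow x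
  obtain ⟨l, b, hb⟩ := dvd_Dm_pow y
  exact ⟨a * Dm N ^ l, b * Dm N ^ k, by
    rw [← mul_assoc, ← mul_assoc, ← ha, ← hb, ← pow_add, ← pow_add, add_comm]⟩

theorem common_lmult {N : ℕ} (x y : BM N) : ∃ a b, a * x = b * y := by
  obtain ⟨a, b, h⟩ := common_mult (rev x) (rev y)
  refine ⟨rev a, rev b, ?_⟩
  have := congrArg rev h
  simpa [rev_mul] using this

noncomputable instance oreTop (N : ℕ) : OreLocalization.OreSet (⊤ : Submonoid (BM N)) where
  ore_right_cancel r₁ r₂ s h := ⟨1, by rw [right_cancel h]⟩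
  oreNum r s := (common_lmult r (s : BM N)).choose_spec.choose
  oreDenom r s := ⟨(common_lmult r (s : BM N)).choose, trivial⟩
  ore_eq r s := (common_lmult r (s : BM N)).choose_spec.choose_spec

abbrev Frac (N : ℕ) := OreLocalization (⊤ : Submonoid (BM N)) (BM N)

noncomputable def fu {N : ℕ} (x : BM N) : (Frac N)ˣ :=
  OreLocalization.numeratorUnit (⟨x, trivial⟩ : (⊤ : Submonoid (BM N)))

theorem fu_mul {N : ℕ} (x y : BM N) : fu (x * y) = fu x * fu y := by
  apply Units.ext
  exact (OreLocalization.numeratorHom (S := (⊤ : Submonoid (BM N)))).map_mul x y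

theorem fu_inj {N : ℕ} {x y : BM N} (h : fu x = fu y) : x = y := by
  have h' : x /ₒ (1 : (⊤ : Submonoid (BM N))) = y /ₒ (1 : (⊤ : Submonoid (BM N))) :=
    congrArg Units.val h
  obtain ⟨u, v, h1, h2⟩ := OreLocalization.oreDiv_eq_iff.1 h'
  simp at h2
  rw [← h2] at h1
  exact (left_cancel (a := (u : BM N)) h1).symm

noncomputable def toFrac (n : ℕ) : BraidGroup n →* (Frac (n - 1))ˣ :=
  PresentedGroup.toGroup (f := fun i => fu (sg i)) (by
    rintro r (⟨i, j, h, rfl⟩ | ⟨i, j, h, rfl⟩)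
    · simp only [map_mul, map_inv, FreeGroup.lift_apply_of, ← fu_mul, sg_rel2 h]
      exact mul_inv_cancel _
    · simp only [map_mul, map_inv, FreeGroup.lift_apply_of, ← fu_mul, sg_rel3 h]
      exact mul_inv_cancel _)

theorem gen_rel2 {n : ℕ} {i j : Fin (n - 1)} (h : (i : ℕ) + 2 ≤ (j : ℕ)) :
    braidGen i * braidGen j = braidGen j * braidGen i := by
  have h1 : PresentedGroup.mk (braidRels n) (FreeGroup.of i * FreeGroup.of j * (FreeGroup.of j * FreeGroup.of i)⁻¹) = 1 :=
    PresentedGroup.one_of_mem (Or.inl ⟨i, j, h, rfl⟩)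
  rw [map_mul, map_inv] at h1
  exact mul_inv_eq_one.1 h1

theorem gen_rel3 {n : ℕ} {i j : Fin (n - 1)} (h : (i : ℕ) + 1 = (j : ℕ)) :
    braidGen i * braidGen j * braidGen i = braidGen j * braidGen i * braidGen j := by
  have h1 : PresentedGroup.mk (braidRels n) (FreeGroup.of i * FreeGroup.of j * FreeGroup.of i * (FreeGroup.of j * FreeGroup.of i * FreeGroup.of j)⁻¹) = 1 :=
    PresentedGroup.one_of_mem (Or.inr ⟨i, j, h, rfl⟩)
  rw [map_mul, map_inv] at h1
  exact mul_inv_eq_one.1 h1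

/-- canonical map from the monoid to the group -/
def io {n : ℕ} : BM (n - 1) →* BraidGroup n :=
  PresentedMonoid.lift (fun i => braidGen i) (by
    rintro a b (⟨i, j, h, rfl, rfl⟩ | ⟨i, j, h, rfl, rfl⟩)
    · simp only [map_mul, FreeMonoid.lift_eval_of, gen_rel2 h]
    · simp only [map_mul, FreeMonoid.lift_eval_of, gen_rel3 h])

@[simp] theorem io_sg {n : ℕ} (i : Fin (n - 1)) : io (sg i) = braidGen i := rfl

theorem toFrac_io {n : ℕ} (x : BM (n - 1)) : toFrac n (io x) = fu x := by
  induction x using BM.ind with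
  | h1 =>
    rw [map_one, map_one]
    have := fu_mul (1 : BM (n - 1)) 1
    rw [mul_one] at this
    exact (mul_eq_left.1 this.symm).symm
  | h2 i x ih =>
    rw [map_mul, map_mul, ih, fu_mul, io_sg]
    congr 1
    exact PresentedGroup.toGroup.of _

theorem io_inj {n : ℕ} {x y : BM (n - 1)} (h : io x = (io y : BraidGroup n)) : x = y := by
  apply fu_inj
  rw [← toFrac_io, h, toFrac_io]

theorem io_mem {n : ℕ} (x : BM (n - 1)) : (io x : BraidGroup n) ∈ PosBraid n := by
  induction x using BM.ind with
  | h1 => rw [map_one]; exact one_mem _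
  | h2 i x ih =>
    rw [map_mul]
    exact mul_mem (Submonoid.subset_closure ⟨i, rfl⟩) ih

theorem io_surj {n : ℕ} {x : BraidGroup n} (h : x ∈ PosBraid n) : ∃ y, io y = x := by
  unfold PosBraid at h
  induction h using Submonoid.closure_induction with
  | mem x hx =>
    obtain ⟨i, rfl⟩ := hx
    exact ⟨sg i, rfl⟩
  | one => exact ⟨1, map_one _⟩
  | mul x y _ _ hx hy =>
    obtain ⟨a, rfl⟩ := hx
    obtain ⟨b, rfl⟩ := hy
    exact ⟨a * b, map_mul _ _ _⟩

theorem io_dvd {n : ℕ} {x y : BM (n - 1)} : DividesL (io x : BraidGroup n) (io y) ↔ x ∣ y := by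
  constructor
  · rintro ⟨z, hz, e⟩
    obtain ⟨w, rfl⟩ := io_surj hz
    rw [← map_mul] at e
    exact ⟨w, io_inj e⟩
  · rintro ⟨w, rfl⟩
    exact ⟨io w, io_mem w, map_mul _ _ _⟩

theorem deltaAux_eq (n m : ℕ) : deltaAux n m = io (DD (sn (n - 1)) m) := by
  induction m with
  | zero => simp [deltaAux, DD]
  | succ m ih =>
    rw [deltaAux, DD, map_mul, ih, cc, map_list_prod, List.map_map]
    congr 3
    funext i
    simp only [sn, Function.comp]
    split_ifs
    · rfl
    · exact (map_one _).symm

theorem delta_eq (n : ℕ) : braidDelta n = io (Dm (n - 1)) := by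
  rw [braidDelta, deltaAux_eq, Dm]
  rcases n with _ | n
  · simp [DD, cc]
  · rfl

end BN

namespace BN

open Equiv

/-- permutation of a braid -/
def pm {N : ℕ} : BM N →* Perm ℕ :=
  PresentedMonoid.lift (rels := brel N) (fun i : Fin N => swap (i : ℕ) (i + 1)) (by
    rintro a b (⟨i, j, h, rfl, rfl⟩ | ⟨i, j, h, rfl, rfl⟩)
    · simp only [map_mul, FreeMonoid.lift_eval_of]
      ext k
      simp only [Perm.mul_apply, swap_apply_def]
      split_ifs <;> omega
    · simp only [map_mul, FreeMonoid.lift_eval_of, ← h]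
      ext k
      simp only [Perm.mul_apply, swap_apply_def]
      split_ifs <;> omega)

@[simp] theorem pm_sg {N : ℕ} (i : Fin N) : pm (sg i) = swap (i : ℕ) (i + 1) := rfl

def invs (N : ℕ) (g : Perm ℕ) : Finset (Σ _ : ℕ, ℕ) :=
  ((Finset.range (N + 1)).sigma (fun b => Finset.range b)).filter (fun p => g p.1 < g p.2)

theorem mem_invs {N : ℕ} {g : Perm ℕ} {p : Σ _ : ℕ, ℕ} :
    p ∈ invs N g ↔ (p.1 ≤ N ∧ p.2 < p.1) ∧ g p.1 < g p.2 := by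
  simp [invs]

theorem invs_erase {N i : ℕ} (hi : i < N) (g : Perm ℕ) :
    ((invs N g).erase ⟨i + 1, i⟩).card ≤ (invs N (g * swap i (i + 1))).card := by
  apply Finset.card_le_card_of_injOn
    (fun p => ⟨swap i (i + 1) p.1, swap i (i + 1) p.2⟩)
  · rintro ⟨b, a⟩ hp
    simp only [Finset.coe_erase, Set.mem_sdiff, Finset.mem_coe, mem_invs, Set.mem_singleton_iff] at hp ⊢
    obtain ⟨⟨⟨h1, h2⟩, h3⟩, h4⟩ := hp
    have h4 : ¬ (b = i + 1 ∧ a = i) := by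
      rintro ⟨rfl, rfl⟩
      exact h4 rfl
    refine ⟨?_, by simpa using h3⟩
    simp only [swap_apply_def]
    split_ifs <;> omega
  · rintro ⟨b, a⟩ _ ⟨b', a'⟩ _ h
    simp only [Sigma.mk.injEq, EmbeddingLike.apply_eq_iff_eq, heq_eq_eq] at h
    obtain ⟨rfl, rfl⟩ := h
    rfl

def gi {N : ℕ} (x : BM N) : Perm ℕ := (pm x)⁻¹

theorem gi_sg_mul {N : ℕ} (i : Fin N) (x : BM N) : gi (sg i * x) = gi x * swap (i : ℕ) (i + 1) := by
  simp [gi]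

def inv {N : ℕ} (x : BM N) : ℕ := (invs N (gi x)).card

theorem inv_sg_mul_le {N : ℕ} (i : Fin N) (x : BM N) : inv (sg i * x) ≤ inv x + 1 := by
  have h := invs_erase i.2 (gi x * swap (i : ℕ) (i + 1))
  rw [mul_assoc, swap_mul_self, mul_one] at h
  have h2 := Finset.pred_card_le_card_erase (s := invs N (gi x * swap (i : ℕ) (i + 1)))
    (a := ⟨(i : ℕ) + 1, i⟩)
  unfold inv
  rw [gi_sg_mul]
  omega

theorem inv_one {N : ℕ} : inv (1 : BM N) = 0 := by
  rw [inv, Finset.card_eq_zero, Finset.eq_empty_iff_forall_notMem]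
  intro p hp
  rw [mem_invs] at hp
  simp [gi] at hp
  omega

theorem inv_le_len {N : ℕ} (x : BM N) : inv x ≤ len x := by
  induction x using BM.ind with
  | h1 => simp [inv_one]
  | h2 i x ih =>
    have := inv_sg_mul_le i x
    simp
    omega

theorem inv_asc {N : ℕ} (i : Fin N) (x : BM N) (h : gi x i < gi x (i + 1)) :
    inv x ≤ inv (sg i * x) := by
  have h1 := invs_erase i.2 (gi x)
  rw [Finset.erase_eq_of_notMem] at h1
  · unfold inv
    rwa [gi_sg_mul]
  · rw [mem_invs]
    simp
    omega

def Red {N : ℕ} (x : BM N) : Prop := len x ≤ inv x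

theorem Red.tail {N : ℕ} {i : Fin N} {x : BM N} (h : Red (sg i * x)) : Red x := by
  have := inv_sg_mul_le i x
  unfold Red at *
  simp at h
  omega

theorem inv_sq {N : ℕ} (i : Fin N) (x : BM N) : inv (sg i * (sg i * x)) = inv x := by
  rw [inv, gi_sg_mul, gi_sg_mul, mul_assoc, swap_mul_self, mul_one, inv]

theorem Red.desc {N : ℕ} {i : Fin N} {x : BM N} (h : Red (sg i * x)) :
    gi (sg i * x) (i + 1) < gi (sg i * x) i := by
  by_contra hc
  have hne : gi (sg i * x) (i + 1) ≠ gi (sg i * x) i := by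
    intro e
    have := (gi (sg i * x)).injective e
    omega
  have h1 := inv_asc i (sg i * x) (by omega)
  rw [inv_sq] at h1
  have h2 := inv_le_len x
  unfold Red at h
  simp at h
  omega

theorem Red.right {N : ℕ} {x y : BM N} (h : Red (x * y)) : Red y := by
  induction x using BM.ind with
  | h1 => simpa using h
  | h2 i x ih =>
    rw [mul_assoc] at h
    exact ih h.tail

theorem gi_tail {N : ℕ} (i : Fin N) (x : BM N) (k : ℕ) :
    gi x k = gi (sg i * x) (swap (i : ℕ) (i + 1) k) := by
  rw [gi_sg_mul]
  simp

theorem Red.dvd {N : ℕ} (L : ℕ) : ∀ {z : BM N} {i : Fin N}, len z ≤ L → Red z →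
    gi z (i + 1) < gi z i → sg i ∣ z := by
  induction L with
  | zero =>
    intro z i hl _ h
    have := len_eq_zero (Nat.le_zero.1 hl)
    subst this
    simp [gi] at h
  | succ L ih =>
    intro z i hl hr h
    rcases BM.cases z with rfl | ⟨j, z, rfl⟩
    · simp [gi] at h
    have hd := hr.desc
    have hr' := hr.tail
    simp at hl
    rcases tri i j with rfl | c | c
    · exact ⟨z, rfl⟩
    · have h1 : gi z (i + 1) < gi z i := by
        rw [gi_tail j z, gi_tail j z]
        unfold Far at c
        rw [swap_apply_of_ne_of_ne (by omega) (by omega),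
          swap_apply_of_ne_of_ne (by omega) (by omega)]
        exact h
      obtain ⟨w, rfl⟩ := ih (by omega) hr' h1
      exact ⟨sg j * w, far_comm c.symm w⟩
    · have h1 : gi z (i + 1) < gi z i := by
        rw [gi_tail j z, gi_tail j z]
        rcases c with c | c
        · rw [c, swap_apply_left, swap_apply_of_ne_of_ne (by omega) (by omega)]
          rw [c] at h
          omega
        · rw [← c, swap_apply_right, swap_apply_of_ne_of_ne (by omega) (by omega)]
          rw [← c] at h
          omega
      obtain ⟨w, rfl⟩ := ih (by omega) hr' h1
      simp at hl
      have h2 : gi w (j + 1) < gi w j := by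
        have c' := c
        unfold Adj at c'
        have e : ∀ k, gi w k = gi (sg j * (sg i * w))
            (swap (j : ℕ) (j + 1) (swap (i : ℕ) (i + 1) k)) :=
          fun k => by rw [gi_tail i w, gi_tail j (sg i * w)]
        have k1 : swap (j : ℕ) (j + 1) (swap (i : ℕ) (i + 1) (j + 1)) = i + 1 := by
          simp only [swap_apply_def]
          split_ifs <;> omega
        have k2 : swap (j : ℕ) (j + 1) (swap (i : ℕ) (i + 1) j) = i := by
          simp only [swap_apply_def]
          split_ifs <;> omega
        rw [e, e, k1, k2]
        exact h
      obtain ⟨v, rfl⟩ := ih (by omega) hr'.tail h2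
      exact ⟨sg j * (sg i * v), adj_braid c.symm v⟩

theorem pm_bound {N : ℕ} (x : BM N) (k : ℕ) (hk : k ≤ N) : pm x k ≤ N := by
  induction x using BM.ind with
  | h1 => simpa using hk
  | h2 i x ih =>
    have := i.2
    rw [map_mul, Perm.mul_apply, pm_sg, swap_apply_def]
    split_ifs <;> omega

theorem pm_rev {N : ℕ} (x : BM N) : pm (rev x) = gi x := by
  induction x using BM.ind with
  | h1 => simp [gi]
  | h2 i x ih =>
    rw [rev_mul, map_mul, ih, gi_sg_mul, rev_sg, pm_sg]

theorem gi_rev {N : ℕ} (x : BM N) : gi (rev x) = pm x := by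
  rw [gi, pm_rev, gi, inv_inv]

theorem inv_le_rev {N : ℕ} (x : BM N) : inv x ≤ inv (rev x) := by
  unfold inv
  apply Finset.card_le_card_of_injOn (fun p => ⟨gi x p.2, gi x p.1⟩)
  · rintro ⟨b, a⟩ hp
    simp only [Finset.mem_coe, mem_invs] at hp ⊢
    refine ⟨⟨?_, hp.2⟩, ?_⟩
    · rw [← pm_rev]
      exact pm_bound _ _ (by omega)
    · rw [gi_rev, gi]
      simp
      omega
  · rintro ⟨b, a⟩ _ ⟨b', a'⟩ _ h
    simp only [Sigma.mk.injEq, EmbeddingLike.apply_eq_iff_eq, heq_eq_eq] at h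
    obtain ⟨rfl, rfl⟩ := h
    rfl

theorem len_rev {N : ℕ} (x : BM N) : len (rev x) = len x := by
  induction x using BM.ind with
  | h1 => simp
  | h2 i x ih => rw [rev_mul, len_mul, len_mul, ih, rev_sg, add_comm]

theorem Red.rev {N : ℕ} {x : BM N} (h : Red x) : Red (rev x) := by
  unfold Red at *
  rw [len_rev]
  exact h.trans (inv_le_rev x)

theorem rev_cc (N m : ℕ) : rev (cc (sn N) m) = cd (sn N) m := by
  induction m with
  | zero => simp [cc, cd]
  | succ m ih =>
    rw [cc_succ, rev_mul, ih, cd]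
    congr 1
    unfold sn
    split_ifs <;> simp

theorem rev_DD (N m : ℕ) : rev (DD (sn N) m) = DD (sn N) m := by
  induction m with
  | zero => simp [DD]
  | succ m ih => rw [DD, rev_mul, ih, rev_cc, ← DD_succ' (sn_BR N), DD]

theorem len_cc (N m : ℕ) (hm : m ≤ N) : len (cc (sn N) m) = m := by
  induction m with
  | zero => simp [cc]
  | succ m ih =>
    rw [cc_succ, len_mul, ih (by omega), sn, dif_pos (by omega), len_sg]

theorem len_DD (N m : ℕ) (hm : m ≤ N + 1) : len (DD (sn N) m) = ∑ k ∈ Finset.range m, k := by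
  induction m with
  | zero => simp [DD]
  | succ m ih =>
    rw [DD, len_mul, ih (by omega), len_cc _ _ (by omega), Finset.sum_range_succ, add_comm]

theorem pm_cc (N m : ℕ) (hm : m ≤ N) (k : ℕ) :
    pm (cc (sn N) m) k = if k < m then k + 1 else if k = m then 0 else k := by
  induction m generalizing k with
  | zero =>
    simp [cc]
  | succ m ih =>
    rw [cc_succ, map_mul, Perm.mul_apply, ih (by omega), sn, dif_pos (by omega), pm_sg,
      swap_apply_def]
    simp only
    split_ifs <;> omega

theorem pm_DD (N m : ℕ) (hm : m ≤ N + 1) (k : ℕ) :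
    pm (DD (sn N) m) k = if k < m then m - 1 - k else k := by
  induction m generalizing k with
  | zero => simp [DD]
  | succ m ih =>
    rw [DD, map_mul, Perm.mul_apply, ih (by omega), pm_cc _ _ (by omega)]
    split_ifs <;> omega

theorem gi_Dm (N k : ℕ) (hk : k ≤ N) : gi (Dm N) k = N - k := by
  rw [gi, Perm.inv_eq_iff_eq, Dm, pm_DD _ _ le_rfl, if_pos (by omega)]
  omega

theorem Red_Dm (N : ℕ) : Red (Dm N) := by
  unfold Red inv
  rw [Dm, len_DD _ _ le_rfl, invs, Finset.filter_true_of_mem, Finset.card_sigma]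
  · simp
  · rintro ⟨b, a⟩ h
    simp at h
    show gi (Dm N) b < gi (Dm N) a
    rw [gi_Dm _ _ (by omega), gi_Dm _ _ (by omega)]
    omega

theorem Red.factor {N : ℕ} {x y z : BM N} (h : x * y * z = Dm N) : Red y := by
  have h1 := Red_Dm N
  rw [← h, mul_assoc] at h1
  have h2 := h1.right.rev
  rw [rev_mul] at h2
  simpa using h2.right.rev

theorem sqfree {N : ℕ} {x z : BM N} {i : Fin N} (h : x * sg i * sg i * z = Dm N) : False := by
  have h1 : Red (sg i * (sg i * z)) := Red.factor (x := x) (z := 1) (by rw [← h]; simp [mul_assoc])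
  unfold Red at h1
  rw [inv_sq] at h1
  have := inv_le_len z
  simp at h1
  omega

theorem exch {N : ℕ} {s : BM N} {i : Fin N} (h : s ∣ Dm N) (h2 : ¬ s * sg i ∣ Dm N) :
    ∃ t, s = t * sg i := by
  obtain ⟨x, hx⟩ := h
  have rs : Red s := Red.factor (x := 1) (z := x) (by simp [hx])
  have rx : Red x := Red.factor (x := s) (z := 1) (by simp [hx])
  rcases lt_trichotomy (pm s i) (pm s (i + 1)) with h | h | h
  · exfalso
    have hb := pm_bound s (i + 1) i.2
    have e : gi x = gi (Dm N) * pm s := by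
      rw [hx, gi, gi, map_mul]; group
    have : sg i ∣ x := by
      refine Red.dvd _ le_rfl rx ?_
      rw [e, Perm.mul_apply, Perm.mul_apply, gi_Dm _ _ hb, gi_Dm _ _ (by omega)]
      omega
    obtain ⟨w, rfl⟩ := this
    exact h2 ⟨w, by rw [hx, mul_assoc]⟩
  · have := (pm s).injective h
    omega
  · have := Red.dvd (i := i) _ le_rfl rs.rev (by rwa [gi_rev])
    obtain ⟨w, hw⟩ := this
    refine ⟨rev w, ?_⟩
    have := congrArg rev hw
    simpa [rev_mul] using this

end BN

namespace BN

def NP {N : ℕ} (s t : BM N) : Prop := ∀ i, sg i ∣ t → ∃ u, s = u * sg i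

theorem eq_one_of_dvd_one {N : ℕ} {x : BM N} (h : x ∣ 1) : x = 1 := by
  obtain ⟨y, hy⟩ := h
  apply len_eq_zero
  have := congrArg len hy
  simp at this
  omega

theorem sg_ne_one {N : ℕ} (i : Fin N) : sg i ≠ 1 := by
  intro h
  have := congrArg len h
  simp at this

theorem dvd_anti {N : ℕ} {x y : BM N} (h : x ∣ y) (h' : y ∣ x) : x = y := by
  obtain ⟨u, hu⟩ := h
  obtain ⟨v, hv⟩ := h'
  have h1 := congrArg len hu
  have h2 := congrArg len hv
  rw [len_mul] at h1 h2
  have : u = 1 := len_eq_zero (by omega)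
  rw [hu, this, mul_one]

theorem dvd_of_mul_dvd {N : ℕ} {a x y : BM N} (h : a * x ∣ a * y) : x ∣ y := by
  obtain ⟨u, hu⟩ := h
  rw [mul_assoc] at hu
  exact ⟨u, left_cancel hu⟩

theorem normal_div {N : ℕ} {s x d : BM N} (hs : s ∣ Dm N) (h : NP s x) (hd : d ∣ s * x)
    (hd' : d ∣ Dm N) : d ∣ s := by
  obtain ⟨m, h1, h2, h3⟩ := lcm_exists _ (s * x) s d le_rfl ⟨x, rfl⟩ hd
  have h4 := h3 _ ⟨x, rfl⟩ hd
  have h5 := h3 _ hs hd'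
  obtain ⟨v, rfl⟩ := h1
  have h6 := dvd_of_mul_dvd h4
  rcases BM.cases v with rfl | ⟨i, w, rfl⟩
  · simpa using h2
  · exfalso
    obtain ⟨u, rfl⟩ := h i ((Dvd.intro _ rfl).trans h6)
    obtain ⟨q, hq⟩ := h5
    exact sqfree (x := u) (i := i) (z := w * q) (by rw [hq]; simp only [mul_assoc])

def Raw {N : ℕ} (l : List (BM N)) : Prop :=
  (∀ s ∈ l, s ∣ Dm N) ∧ List.IsChain NP l ∧ ∀ h : l ≠ [], l.getLast h ≠ 1

theorem Raw_nil {N : ℕ} : Raw ([] : List (BM N)) := by simp [Raw]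

theorem prod_one {N : ℕ} {l : List (BM N)} (h : Raw l) (h1 : l.prod = 1) : l = [] := by
  by_contra hc
  apply h.2.2 hc
  have h2 : ∀ l : List (BM N), l.prod = 1 → ∀ x ∈ l, x = 1 := by
    intro l
    induction l with
    | nil => simp
    | cons a l ih =>
      intro hp x hx
      rw [List.prod_cons] at hp
      have ha : a = 1 := eq_one_of_dvd_one ⟨_, hp.symm⟩
      rw [ha, one_mul] at hp
      rcases List.mem_cons.1 hx with rfl | hx
      · exact ha
      · exact ih hp x hx
  exact h2 l h1 _ (List.getLast_mem hc)

theorem Raw_cons {N : ℕ} (l : List (BM N)) : ∀ s, Raw (s :: l) ↔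
    s ∣ Dm N ∧ s ≠ 1 ∧ NP s l.prod ∧ Raw l := by
  induction l with
  | nil =>
    intro s
    have : NP s 1 := fun i h => absurd (eq_one_of_dvd_one h) (sg_ne_one i)
    simp [Raw, this]
  | cons t l ih =>
    intro s
    have e : Raw (s :: t :: l) ↔ s ∣ Dm N ∧ NP s t ∧ Raw (t :: l) := by
      simp only [Raw, List.isChain_cons_cons, List.forall_mem_cons, List.getLast_cons_cons, ne_eq,
        reduceCtorEq, not_false_eq_true, forall_const]
      tauto
    rw [e]
    constructor
    · rintro ⟨h1, h2, h3⟩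
      obtain ⟨h4, h5, h6, h7⟩ := (ih t).1 h3
      have h8 : NP s (t :: l).prod := by
        intro i hi
        rw [List.prod_cons] at hi
        exact h2 i (normal_div h4 h6 hi (dvd_Dm i))
      refine ⟨h1, ?_, h8, h3⟩
      rintro rfl
      rcases BM.cases t with rfl | ⟨i, w, rfl⟩
      · exact h5 rfl
      · obtain ⟨u, hu⟩ := h2 i ⟨w, rfl⟩
        have := congrArg len hu
        simp at this
    · rintro ⟨h1, h2, h3, h4⟩
      refine ⟨h1, fun i hi => h3 i ?_, h4⟩
      rw [List.prod_cons]
      exact hi.trans ⟨_, rfl⟩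

theorem Raw_uniq {N : ℕ} (l : List (BM N)) : ∀ m, Raw l → Raw m → l.prod = m.prod → l = m := by
  induction l with
  | nil => exact fun m _ h h' => (prod_one h h'.symm).symm
  | cons s l ih =>
    intro m hl hm h
    rcases m with _ | ⟨t, m⟩
    · exact prod_one hl h
    · obtain ⟨a1, a2, a3, a4⟩ := (Raw_cons _ _).1 hl
      obtain ⟨b1, b2, b3, b4⟩ := (Raw_cons _ _).1 hm
      simp only [List.prod_cons] at h
      have e : s = t := dvd_anti (normal_div b1 b3 ⟨_, h.symm⟩ a1) (normal_div a1 a3 ⟨_, h⟩ b1)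
      subst e
      rw [ih m a4 b4 (left_cancel h)]

theorem Raw_exists {N : ℕ} (L : ℕ) : ∀ x : BM N, len x ≤ L → ∃ l, Raw l ∧ l.prod = x := by
  induction L with
  | zero =>
    intro x hx
    have := len_eq_zero (Nat.le_zero.1 hx)
    exact ⟨[], Raw_nil, by simp [this]⟩
  | succ L ih =>
    intro x hx
    rcases BM.cases x with rfl | ⟨i, w, hw⟩
    · exact ⟨[], Raw_nil, by simp⟩
    obtain ⟨s, h1, h2, h3⟩ := gcd_exists x (Dm N)
    have hs : s ≠ 1 := by
      rintro rfl
      exact sg_ne_one i (eq_one_of_dvd_one (h3 _ ⟨w, hw⟩ (dvd_Dm i)))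
    have hs' : len s ≠ 0 := fun h => hs (len_eq_zero h)
    obtain ⟨y, rfl⟩ := h1
    rw [len_mul] at hx
    obtain ⟨l, hl, rfl⟩ := ih y (by omega)
    refine ⟨s :: l, (Raw_cons _ _).2 ⟨h2, hs, ?_, hl⟩, by simp⟩
    intro j hj
    by_contra hc
    have h4 : s * sg j ∣ Dm N := by
      by_contra h5
      exact hc (exch h2 h5)
    obtain ⟨q, hq⟩ := h3 _ (mul_dvd_mul_left s hj) h4
    have := congrArg len hq
    simp at this
    omega

def Cop {N : ℕ} (x y : BM N) : Prop := ∀ d, d ∣ x → d ∣ y → d = 1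

theorem Raw_cop {N : ℕ} (l m : List (BM N)) (hl : Raw l) (hm : Raw m) : Cop l.prod m.prod ↔
    ∀ (h1 : l ≠ []) (h2 : m ≠ []), Cop (l.head h1) (m.head h2) := by
  rcases l with _ | ⟨s, l⟩
  · simp only [ne_eq, not_true_eq_false, IsEmpty.forall_iff, iff_true]
    exact fun d h _ => eq_one_of_dvd_one h
  rcases m with _ | ⟨t, m⟩
  · simp only [ne_eq, not_true_eq_false, IsEmpty.forall_iff, iff_true, implies_true]
    exact fun d _ h => eq_one_of_dvd_one h
  obtain ⟨a1, a2, a3, a4⟩ := (Raw_cons _ _).1 hl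
  obtain ⟨b1, b2, b3, b4⟩ := (Raw_cons _ _).1 hm
  simp only [List.prod_cons, List.head_cons, ne_eq, reduceCtorEq, not_false_eq_true, forall_const]
  constructor
  · exact fun h d hd hd' => h d (hd.trans ⟨_, rfl⟩) (hd'.trans ⟨_, rfl⟩)
  · intro h d hd hd'
    rcases BM.cases d with rfl | ⟨i, w, rfl⟩
    · rfl
    · have hi : sg i ∣ sg i * w := ⟨w, rfl⟩
      exact absurd (h (sg i) (normal_div a1 a3 (hi.trans hd) (dvd_Dm i))
        (normal_div b1 b3 (hi.trans hd') (dvd_Dm i))) (sg_ne_one i)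

theorem cop_aux {N : ℕ} {a b s t s' t' : BM N} (h : Cop s t) (h1 : a * s = b * s')
    (h2 : a * t = b * t') : b ∣ a := by
  obtain ⟨g, g1, g2, g3⟩ := gcd_exists (a * s) (a * t)
  obtain ⟨u, rfl⟩ := g3 a ⟨s, rfl⟩ ⟨t, rfl⟩
  have := h u (dvd_of_mul_dvd g1) (dvd_of_mul_dvd g2)
  subst this
  rw [mul_one] at g3
  exact g3 b ⟨_, h1⟩ ⟨_, h2⟩

theorem frac_exists {n : ℕ} (z : BraidGroup n) :
    ∃ s t : BM (n - 1), z = (io t)⁻¹ * io s := by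
  have hz : z ∈ Subgroup.closure (Set.range (braidGen (n := n))) := by
    have := PresentedGroup.closure_range_of (braidRels n)
    have h2 : z ∈ (⊤ : Subgroup (BraidGroup n)) := trivial
    exact (SetLike.ext_iff.1 this z).2 h2
  induction hz using Subgroup.closure_induction_right with
  | one => exact ⟨1, 1, by simp⟩
  | mul_right x hx y hy ih =>
    obtain ⟨i, rfl⟩ := hy
    obtain ⟨s, t, rfl⟩ := ih
    exact ⟨s * sg i, t, by rw [map_mul, io_sg, mul_assoc]⟩
  | mul_inv_cancel x hx y hy ih =>
    obtain ⟨i, rfl⟩ := hy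
    obtain ⟨s, t, rfl⟩ := ih
    obtain ⟨a, b, hab⟩ := common_lmult s (sg i)
    have h := congrArg (io (n := n)) hab
    simp only [map_mul, io_sg] at h
    refine ⟨b, a * t, ?_⟩
    have e : io b = io a * io s * (braidGen i)⁻¹ := by rw [h]; group
    rw [e, map_mul]
    group

theorem frac_cop {n : ℕ} (z : BraidGroup n) :
    ∃ s t : BM (n - 1), Cop s t ∧ z = (io t)⁻¹ * io s := by
  obtain ⟨s, t, rfl⟩ := frac_exists z
  obtain ⟨g, g1, g2, g3⟩ := gcd_exists s t
  obtain ⟨s, rfl⟩ := g1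
  obtain ⟨t, rfl⟩ := g2
  refine ⟨s, t, ?_, by simp only [map_mul]; group⟩
  intro d hd hd'
  have := g3 (g * d) (mul_dvd_mul_left g hd) (mul_dvd_mul_left g hd')
  obtain ⟨q, hq⟩ := this
  have := congrArg len hq
  simp at this
  exact len_eq_zero (by omega)

theorem frac_uniq {n : ℕ} {s t s' t' : BM (n - 1)} (h : Cop s t) (h' : Cop s' t')
    (e : ((io t)⁻¹ * io s : BraidGroup n) = (io t')⁻¹ * io s') : s = s' ∧ t = t' := by
  obtain ⟨a, b, hab⟩ := common_lmult t t'
  have h1 := congrArg (io (n := n)) hab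
  simp only [map_mul] at h1
  have h2 : a * s = b * s' := by
    apply io_inj (n := n)
    rw [map_mul, map_mul]
    have : io s = io t * ((io t')⁻¹ * io s' : BraidGroup n) := by rw [← e]; group
    rw [this, ← mul_assoc, h1]
    group
  have : a = b := dvd_anti (cop_aux h' h2.symm hab.symm) (cop_aux h h2 hab)
  subst this
  exact ⟨left_cancel h2, left_cancel hab⟩

theorem io_dvdR {n : ℕ} {x y : BM (n - 1)} :
    DividesR (io x : BraidGroup n) (io y) ↔ ∃ u, y = u * x := by
  constructor
  · rintro ⟨z, hz, h⟩
    obtain ⟨u, rfl⟩ := io_surj hz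
    exact ⟨u, io_inj (n := n) (by rw [h, map_mul])⟩
  · rintro ⟨u, rfl⟩
    exact ⟨io u, io_mem u, map_mul _ _ _⟩

theorem io_NP {n : ℕ} {x y : BM (n - 1)} :
    NormalPair (io x : BraidGroup n) (io y) ↔ NP x y := by
  unfold NormalPair NP
  simp only [← io_sg, io_dvd, io_dvdR]

theorem io_simple {n : ℕ} {x : BM (n - 1)} : Simple (io x : BraidGroup n) ↔ x ∣ Dm (n - 1) := by
  unfold Simple
  rw [delta_eq, io_dvd]
  simp [io_mem]

theorem io_raw {n : ℕ} (l : List (BM (n - 1))) : Raw l ↔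
    (∀ s ∈ l.map (io (n := n)), Simple s) ∧ List.Chain' NormalPair (l.map (io (n := n))) ∧
      ∀ h : l.map (io (n := n)) ≠ [], (l.map (io (n := n))).getLast h ≠ 1 := by
  have e1 : List.Chain' NormalPair (l.map (io (n := n))) ↔ List.IsChain NP l := by
    show List.IsChain _ _ ↔ _
    rw [List.isChain_map]
    simp only [io_NP]
  rw [e1, Raw]
  have e2 : ∀ x : BM (n - 1), (io x : BraidGroup n) = 1 ↔ x = 1 := fun x =>
    ⟨fun h => io_inj (n := n) (by rw [h, map_one]), fun h => by rw [h, map_one]⟩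
  simp [io_simple, e2]

theorem lift_list {n : ℕ} (l : List (BraidGroup n)) (h : ∀ s ∈ l, Simple s) :
    ∃ m : List (BM (n - 1)), l = m.map io := by
  induction l with
  | nil => exact ⟨[], rfl⟩
  | cons a l ih =>
    obtain ⟨m, rfl⟩ := ih fun s hs => h s (List.mem_cons_of_mem _ hs)
    obtain ⟨x, rfl⟩ := io_surj (h a List.mem_cons_self).1
    exact ⟨x :: m, rfl⟩

theorem io_cop {n : ℕ} (x y : BM (n - 1)) : Cop x y ↔
    ∀ d ∈ PosBraid n, DividesL d (io x : BraidGroup n) → DividesL d (io y) → d = 1 := by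
  constructor
  · intro h d hd
    obtain ⟨d, rfl⟩ := io_surj hd
    rw [io_dvd, io_dvd]
    intro h1 h2
    rw [h d h1 h2, map_one]
  · intro h d h1 h2
    apply io_inj (n := n)
    rw [map_one]
    exact h _ (io_mem d) (io_dvd.2 h1) (io_dvd.2 h2)

theorem io_headcop {n : ℕ} (l m : List (BM (n - 1))) (hl : Raw l) (hm : Raw m) :
    Cop l.prod m.prod ↔
    ∀ (h1 : l.map (io (n := n)) ≠ []) (h2 : m.map (io (n := n)) ≠ []), ∀ d ∈ PosBraid n,
      DividesL d ((l.map io).head h1) → DividesL d ((m.map io).head h2) → d = 1 := by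
  rw [Raw_cop l m hl hm]
  simp only [io_cop (n := n), List.head_map, ne_eq, List.map_eq_nil_iff]

end BN

/-- Theorem (symmetric normal form): every braid `z` admits a unique
decomposition `t_q⁻¹ ⋯ t_1⁻¹ s_1 ⋯ s_p` with `(s_1, …, s_p)` and
`(t_1, …, t_q)` normal sequences of simple braids such that `s_p ≠ 1`,
`t_q ≠ 1`, and `gcd_L(s_1, t_1) = 1`. -/
theorem symmetric_normal_form (n : ℕ) (z : BraidGroup n) :
    ∃! p : List (BraidGroup n) × List (BraidGroup n),
      (∀ s ∈ p.1, Simple s) ∧ (∀ t ∈ p.2, Simple t) ∧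
      List.Chain' NormalPair p.1 ∧ List.Chain' NormalPair p.2 ∧
      (∀ h : p.1 ≠ [], p.1.getLast h ≠ 1) ∧
      (∀ h : p.2 ≠ [], p.2.getLast h ≠ 1) ∧
      (∀ (h1 : p.1 ≠ []) (h2 : p.2 ≠ []), ∀ d ∈ PosBraid n,
          DividesL d (p.1.head h1) → DividesL d (p.2.head h2) → d = 1) ∧
      z = (p.2.prod)⁻¹ * p.1.prod := by 
  obtain ⟨s, t, hc, hz⟩ := BN.frac_cop z
  obtain ⟨l, hl, rfl⟩ := BN.Raw_exists _ s le_rfl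
  obtain ⟨m, hm, rfl⟩ := BN.Raw_exists _ t le_rfl
  refine ⟨(l.map BN.io, m.map BN.io), ?_, ?_⟩
  · have a := (BN.io_raw (n := n) l).1 hl
    have b := (BN.io_raw (n := n) m).1 hm
    refine ⟨a.1, b.1, a.2.1, b.2.1, a.2.2, b.2.2, (BN.io_headcop (n := n) l m hl hm).1 hc, ?_⟩
    rw [hz, map_list_prod, map_list_prod]
  · rintro ⟨l', m'⟩ ⟨a1, b1, a2, b2, a3, b3, h, e⟩
    dsimp only at a1 b1 a2 b2 a3 b3 h e
    obtain ⟨l', rfl⟩ := BN.lift_list l' a1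
    obtain ⟨m', rfl⟩ := BN.lift_list m' b1
    have hl' := (BN.io_raw (n := n) l').2 ⟨a1, a2, a3⟩
    have hm' := (BN.io_raw (n := n) m').2 ⟨b1, b2, b3⟩
    have hc' := (BN.io_headcop (n := n) l' m' hl' hm').2 h
    rw [hz, ← map_list_prod, ← map_list_prod] at e
    obtain ⟨e1, e2⟩ := BN.frac_uniq hc hc' e
    rw [BN.Raw_uniq l l' hl hl' e1, BN.Raw_uniq m m' hm hm' e2]
end

section
/- For positive braids x, y in B_n^+, define α(x) = gcd_L(x, Δ_n). Then α(xy) = α(x·α(y)). -/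
namespace BraidAux

/-- Adjacency of generators. -/
def Adj {N : ℕ} (i j : Fin N) : Prop := (i : ℕ) + 1 = j ∨ (j : ℕ) + 1 = i

theorem Adj.symm {N : ℕ} {i j : Fin N} (h : Adj i j) : Adj j i := Or.symm h

/-- Equivalence of positive braid words. -/
inductive BEqv {N : ℕ} : List (Fin N) → List (Fin N) → Prop
  | refl (u) : BEqv u u
  | symm {u v} : BEqv u v → BEqv v u
  | trans {u v w} : BEqv u v → BEqv v w → BEqv u w
  | cons (i) {u v} : BEqv u v → BEqv (i :: u) (i :: v)
  | far {i j : Fin N} (u) : i ≠ j → ¬ Adj i j → BEqv (i :: j :: u) (j :: i :: u)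
  | adj {i j : Fin N} (u) : Adj i j → BEqv (i :: j :: i :: u) (j :: i :: j :: u)

variable {N : ℕ}

theorem BEqv.length {u v : List (Fin N)} (h : BEqv u v) : u.length = v.length := by
  induction h <;> simp_all

theorem BEqv.append_right {u v : List (Fin N)} (h : BEqv u v) (w) : BEqv (u ++ w) (v ++ w) := by
  induction h with
  | refl u => exact .refl _
  | symm _ ih => exact ih.symm
  | trans _ _ h1 h2 => exact h1.trans h2
  | cons i _ ih => exact .cons i ih
  | far u h1 h2 => exact .far _ h1 h2
  | adj u h1 => exact .adj _ h1

theorem BEqv.append_left {u v : List (Fin N)} (h : BEqv u v) (w) : BEqv (w ++ u) (w ++ v) := by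
  induction w with
  | nil => exact h
  | cons i w ih => exact .cons i ih

theorem BEqv.reverse {u v : List (Fin N)} (h : BEqv u v) : BEqv u.reverse v.reverse := by
  induction h with
  | refl u => exact .refl _
  | symm _ ih => exact ih.symm
  | trans _ _ h1 h2 => exact h1.trans h2
  | cons i _ ih => simpa using ih.append_right [i]
  | far u h1 h2 =>
    simpa using (BEqv.far [] h1.symm (fun h => h2 h.symm)).append_left u.reverse
  | adj u h1 =>
    simpa using (BEqv.adj [] h1).append_left u.reverse

/-- The setoid of words. -/
def bsetoid (N : ℕ) : Setoid (List (Fin N)) := ⟨BEqv, ⟨.refl, .symm, .trans⟩⟩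

/-- The positive braid monoid given by its presentation. -/
def M (N : ℕ) : Type := Quotient (bsetoid N)

/-- Class of a word. -/
def mk (u : List (Fin N)) : M N := Quotient.mk (bsetoid N) u

theorem mk_eq {u v : List (Fin N)} : mk u = mk v ↔ BEqv u v :=
  ⟨fun h => Quotient.exact h, fun h => Quotient.sound h⟩

theorem mk_surj (x : M N) : ∃ u, mk u = x := Quotient.exists_rep x

instance : Monoid (M N) where
  mul := Quotient.map₂ (· ++ ·) (fun _ _ h _ _ h' =>
    BEqv.trans (BEqv.append_right h _) (BEqv.append_left h' _))
  one := mk []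
  mul_assoc := by
    rintro ⟨a⟩ ⟨b⟩ ⟨c⟩
    exact congrArg mk (List.append_assoc a b c)
  one_mul := by
    rintro ⟨a⟩
    rfl
  mul_one := by
    rintro ⟨a⟩
    exact congrArg mk (List.append_nil a)

theorem mk_append (u v : List (Fin N)) : mk (u ++ v) = mk u * mk v := rfl
theorem mk_nil : mk ([] : List (Fin N)) = 1 := rfl

/-- Generators. -/
def g (i : Fin N) : M N := mk [i]

theorem mk_cons (i) (u : List (Fin N)) : mk (i :: u) = g i * mk u := rfl

theorem M_ind {P : M N → Prop} (h1 : P 1) (h2 : ∀ i x, P x → P (g i * x)) (x : M N) : P x := by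
  obtain ⟨u, rfl⟩ := mk_surj x
  induction u with
  | nil => exact h1
  | cons i u ih => exact h2 i _ ih

/-- Length. -/
def len : M N → ℕ := Quotient.lift List.length (fun _ _ h => BEqv.length h)

theorem len_mk (u : List (Fin N)) : len (mk u) = u.length := rfl

@[simp] theorem len_mul (x y : M N) : len (x * y) = len x + len y := by
  obtain ⟨u, rfl⟩ := mk_surj x
  obtain ⟨v, rfl⟩ := mk_surj y
  rw [← mk_append]; simp [len_mk]

@[simp] theorem len_g (i : Fin N) : len (g i) = 1 := rfl
@[simp] theorem len_one : len (1 : M N) = 0 := rfl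

theorem eq_one_of_len {x : M N} (h : len x = 0) : x = 1 := by
  obtain ⟨u, rfl⟩ := mk_surj x
  rw [len_mk, List.length_eq_zero_iff] at h
  rw [h, mk_nil]

theorem gfar {i j : Fin N} (h : i ≠ j) (h' : ¬ Adj i j) (x : M N) :
    g i * (g j * x) = g j * (g i * x) := by
  obtain ⟨u, rfl⟩ := mk_surj x
  exact mk_eq.2 (.far u h h')

theorem gadj {i j : Fin N} (h : Adj i j) (x : M N) :
    g i * (g j * (g i * x)) = g j * (g i * (g j * x)) := by
  obtain ⟨u, rfl⟩ := mk_surj x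
  exact mk_eq.2 (.adj u h)

open Classical in
/-- Right complement of generators. -/
noncomputable def C (i j : Fin N) : M N :=
  if i = j then 1 else if Adj i j then g j * g i else g j

theorem C_self (i : Fin N) : C i i = 1 := by simp [C]
theorem C_far {i j : Fin N} (h : i ≠ j) (h' : ¬ Adj i j) : C i j = g j := by simp [C, h, h']
theorem C_adj {i j : Fin N} (h : Adj i j) : C i j = g j * g i := by
  have : i ≠ j := by rintro rfl; unfold Adj at h; omega
  simp [C, h, this]

theorem C_eq (i j : Fin N) : g i * C i j = g j * C j i := by
  by_cases h : i = j
  · subst h; rfl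
  by_cases h' : Adj i j
  · rw [C_adj h', C_adj h'.symm]
    simpa using gadj h' 1
  · rw [C_far h h', C_far (Ne.symm h) (fun q => h' q.symm)]
    have key := gfar h h' 1
    simpa using key

/-- Garside property up to a given length. -/
def Gar (N L : ℕ) : Prop := ∀ (i j : Fin N) (a b : M N), len a < L → g i * a = g j * b →
  ∃ w, a = C i j * w ∧ b = C j i * w

theorem Gar.cancel {L : ℕ} (h : Gar N L) {i : Fin N} {a b : M N} (hl : len a < L)
    (he : g i * a = g i * b) : a = b := by
  obtain ⟨w, h1, h2⟩ := h i i a b hl he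
  rw [h1, h2]

theorem Gar.far {L : ℕ} (h : Gar N L) {i j : Fin N} (hij : i ≠ j) (hij' : ¬ Adj i j) {a b : M N}
    (hl : len a < L) (he : g i * a = g j * b) : ∃ w, a = g j * w ∧ b = g i * w := by
  obtain ⟨w, h1, h2⟩ := h i j a b hl he
  rw [C_far hij hij'] at h1
  rw [C_far hij.symm (fun q => hij' q.symm)] at h2
  exact ⟨w, h1, h2⟩

theorem Gar.adj {L : ℕ} (h : Gar N L) {i j : Fin N} (hij : Adj i j) {a b : M N}
    (hl : len a < L) (he : g i * a = g j * b) :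
    ∃ w, a = g j * (g i * w) ∧ b = g i * (g j * w) := by
  obtain ⟨w, h1, h2⟩ := h i j a b hl he
  rw [C_adj hij, mul_assoc] at h1
  rw [C_adj hij.symm, mul_assoc] at h2
  exact ⟨w, h1, h2⟩

/-- case: `k` adjacent to `i` only -/
theorem cube3 {L : ℕ} (h : Gar N L) {i j k : Fin N} (hkj : k ≠ j) (hij : i ≠ j)
    (ki : Adj k i) (kj : ¬ Adj k j) (ij : ¬ Adj i j) {w1 w2 : M N}
    (hl : len w1 + 2 ≤ L) (he : g i * (g k * w1) = g j * w2) :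
    ∃ w, g k * (g i * w1) = g j * w ∧ g k * w2 = g i * w := by
  obtain ⟨w', e1, e2⟩ := h.far hij ij (by simp; omega) he
  obtain ⟨x, e3, e4⟩ := h.far hkj kj (by omega) e1
  subst e3 e4 e2
  refine ⟨g k * (g i * x), ?_, ?_⟩
  · rw [gfar hij ij, gfar hkj kj]
  · rw [gadj ki]

/-- case: `i` adjacent to both -/
theorem cube6 {L : ℕ} (h : Gar N L) {i j k : Fin N} (hkj : k ≠ j)
    (ki : Adj k i) (kj : ¬ Adj k j) (ij : Adj i j) {w1 w2 : M N}
    (hl : len w1 + 2 ≤ L) (he : g i * (g k * w1) = g j * w2) :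
    ∃ w, g k * (g i * w1) = g j * (g i * w) ∧ g k * w2 = g i * (g j * w) := by
  obtain ⟨w', e1, e2⟩ := h.adj ij (by simp; omega) he
  have hlen := congrArg len e1
  simp only [len_mul, len_g] at hlen
  obtain ⟨a, e3, e4⟩ := h.far hkj kj (by omega) e1
  obtain ⟨b, e5, e6⟩ := h.adj ki.symm (by omega) e4
  subst e5 e6 e3 e2
  refine ⟨g k * (g i * (g j * b)), ?_, ?_⟩
  · rw [gadj ij, gfar hkj kj, ← gfar hkj kj b, gadj ki]
  · rw [← gfar hkj kj (g i * b), gadj ki, gadj ij b, gfar hkj kj]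

/-- case: `k` adjacent to both -/
theorem cube5 {L : ℕ} (h : Gar N L) {i j k : Fin N} (hij : i ≠ j)
    (ki : Adj k i) (kj : Adj k j) (ij : ¬ Adj i j) {w1 w2 : M N}
    (hl : len w1 + 2 ≤ L) (he : g i * (g k * w1) = g j * (g k * w2)) :
    ∃ w, g k * (g i * w1) = g j * w ∧ g k * (g j * w2) = g i * w := by
  have hlen := congrArg len he
  simp only [len_mul, len_g] at hlen
  obtain ⟨a, e1, e2⟩ := h.far hij ij (by simp; omega) he
  obtain ⟨b, e3, e4⟩ := h.adj kj (by omega) e1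
  obtain ⟨c, e5, e6⟩ := h.adj ki (by omega) e2
  subst e4
  have hlen2 := congrArg len e3
  simp only [len_mul, len_g] at hlen2
  have e7 := h.cancel (by simp; omega) e6
  obtain ⟨d, e8, e9⟩ := h.far hij.symm (fun q => ij q.symm) (by omega) e7
  subst e8 e9 e3 e5
  refine ⟨g k * (g j * (g i * (g k * d))), ?_, ?_⟩
  · rw [gfar hij ij, gadj ki.symm, gadj kj]
  · rw [← gfar hij ij, gadj kj.symm, gadj ki, gfar hij ij]

theorem cube {L : ℕ} (h : Gar N L) (i j k : Fin N) (w1 w2 : M N)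
    (hl : len (C k i * w1) ≤ L) (he : C k i * w1 = C k j * w2) :
    ∃ w, C i k * w1 = C i j * w ∧ C j k * w2 = C j i * w := by
  by_cases hki : k = i
  · subst hki
    rw [C_self, one_mul] at *
    exact ⟨w2, he, rfl⟩
  by_cases hkj : k = j
  · subst hkj
    rw [C_self, one_mul] at *
    exact ⟨w1, rfl, he.symm⟩
  have hik := Ne.symm hki
  have hjk := Ne.symm hkj
  have hlen := congrArg len he
  by_cases hij : i = j
  · subst hij
    have : w1 = w2 := by
      by_cases ki : Adj k i
      · simp only [C_adj ki, mul_assoc] at he hl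
        simp only [len_mul, len_g] at hl
        exact h.cancel (by omega) (h.cancel (by simp; omega) he)
      · rw [C_far hki ki] at he hl
        simp only [len_mul, len_g] at hl
        exact h.cancel (by omega) he
    subst this
    exact ⟨C i k * w1, by simp [C_self], by simp [C_self]⟩
  have hji := Ne.symm hij
  by_cases ki : Adj k i <;> by_cases kj : Adj k j <;> by_cases ij : Adj i j
  · exfalso; unfold Adj at *; omega
  · have ji : ¬ Adj j i := fun q => ij q.symm
    rw [C_adj ki, C_adj kj] at *
    rw [C_adj ki.symm, C_adj kj.symm, C_far hij ij, C_far hji ji]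
    simp only [mul_assoc, len_mul, len_g] at *
    exact cube5 h hij ki kj ij (by omega) he
  · have jk : ¬ Adj j k := fun q => kj q.symm
    rw [C_adj ki, C_far hkj kj] at *
    rw [C_adj ki.symm, C_far hjk jk, C_adj ij, C_adj ij.symm]
    simp only [mul_assoc, len_mul, len_g] at *
    exact cube6 h hkj ki kj ij (by omega) he
  · have jk : ¬ Adj j k := fun q => kj q.symm
    have ji : ¬ Adj j i := fun q => ij q.symm
    rw [C_adj ki, C_far hkj kj] at *
    rw [C_adj ki.symm, C_far hjk jk, C_far hij ij, C_far hji ji]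
    simp only [mul_assoc, len_mul, len_g] at *
    exact cube3 h hkj hij ki kj ij (by omega) he
  · have ik : ¬ Adj i k := fun q => ki q.symm
    rw [C_adj kj, C_far hki ki] at *
    rw [C_adj kj.symm, C_far hik ik, C_adj ij, C_adj ij.symm]
    simp only [mul_assoc, len_mul, len_g] at *
    obtain ⟨w, h1, h2⟩ := cube6 h hki kj ki ij.symm (by omega) he.symm
    exact ⟨w, h2, h1⟩
  · have ik : ¬ Adj i k := fun q => ki q.symm
    have ji : ¬ Adj j i := fun q => ij q.symm
    rw [C_adj kj, C_far hki ki] at *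
    rw [C_adj kj.symm, C_far hik ik, C_far hij ij, C_far hji ji]
    simp only [mul_assoc, len_mul, len_g] at *
    obtain ⟨w, h1, h2⟩ := cube3 h hki hji kj ki ji (by omega) he.symm
    exact ⟨w, h2, h1⟩
  · have ik : ¬ Adj i k := fun q => ki q.symm
    have jk : ¬ Adj j k := fun q => kj q.symm
    rw [C_far hkj kj, C_far hki ki] at *
    rw [C_far hjk jk, C_far hik ik, C_adj ij, C_adj ij.symm]
    simp only [mul_assoc, len_mul, len_g] at *
    obtain ⟨w, h1, h2⟩ := h.adj ij (by omega) he
    subst h1 h2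
    refine ⟨g k * w, ?_, ?_⟩
    · rw [gfar hkj kj, gfar hki ki]
    · rw [gfar hki ki, gfar hkj kj]
  · have ik : ¬ Adj i k := fun q => ki q.symm
    have jk : ¬ Adj j k := fun q => kj q.symm
    have ji : ¬ Adj j i := fun q => ij q.symm
    rw [C_far hkj kj, C_far hki ki] at *
    rw [C_far hjk jk, C_far hik ik, C_far hij ij, C_far hji ji]
    simp only [mul_assoc, len_mul, len_g] at *
    obtain ⟨w, h1, h2⟩ := h.far hij ij (by omega) he
    subst h1 h2
    exact ⟨g k * w, gfar hkj kj _, gfar hki ki _⟩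

theorem gar_step {L : ℕ} (h : Gar N L) {x y : List (Fin N)} (hxy : BEqv x y) :
    x.length ≤ L + 1 → ∀ i j u v, x = i :: u → y = j :: v →
      ∃ w, mk u = C i j * w ∧ mk v = C j i * w := by
  induction hxy with
  | refl u =>
    rintro - i j u v rfl h2
    obtain ⟨rfl, rfl⟩ := List.cons.inj h2
    exact ⟨mk u, by simp [C_self], by simp [C_self]⟩
  | symm h1 ih =>
    intro hl i j u v e1 e2
    obtain ⟨w, a, b⟩ := ih (h1.length ▸ hl) j i v u e2 e1
    exact ⟨w, b, a⟩
  | @trans x y z h1 h2 ih1 ih2 =>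
    intro hl i j u v e1 e2
    cases y with
    | nil => have := h1.length; simp [e1] at this
    | cons k t =>
      have hl' := h1.length
      obtain ⟨w1, a1, b1⟩ := ih1 hl i k u t e1 rfl
      obtain ⟨w2, a2, b2⟩ := ih2 (hl' ▸ hl) k j t v rfl e2
      rw [a1, b2]
      refine cube h i j k w1 w2 ?_ (b1.symm.trans a2)
      rw [← b1, len_mk]
      simp at hl'
      omega
  | cons i h1 ih =>
    rintro - i' j u v e1 e2
    obtain ⟨rfl, rfl⟩ := List.cons.inj e1
    obtain ⟨rfl, rfl⟩ := List.cons.inj e2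
    exact ⟨mk _, by rw [C_self, one_mul], by rw [C_self, one_mul, mk_eq.2 h1]⟩
  | far u h1 h2 =>
    rintro - i' j u' v e1 e2
    obtain ⟨rfl, rfl⟩ := List.cons.inj e1
    obtain ⟨rfl, rfl⟩ := List.cons.inj e2
    exact ⟨mk u, by rw [C_far h1 h2, mk_cons], by
      rw [C_far h1.symm (fun q => h2 q.symm), mk_cons]⟩
  | adj u h1 =>
    rintro - i' j u' v e1 e2
    obtain ⟨rfl, rfl⟩ := List.cons.inj e1
    obtain ⟨rfl, rfl⟩ := List.cons.inj e2
    exact ⟨mk u, by rw [C_adj h1, mul_assoc]; rfl, by rw [C_adj h1.symm, mul_assoc]; rfl⟩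

theorem gar_all (N L : ℕ) : Gar N L := by
  induction L with
  | zero => intro i j a b h; omega
  | succ L ih =>
    intro i j a b hl he
    obtain ⟨u, rfl⟩ := mk_surj a
    obtain ⟨v, rfl⟩ := mk_surj b
    rw [len_mk] at hl
    exact gar_step ih (mk_eq.1 he) (by simp; omega) i j u v rfl rfl

theorem gar (i j : Fin N) (a b : M N) (h : g i * a = g j * b) :
    ∃ w, a = C i j * w ∧ b = C j i * w := gar_all N (len a + 1) i j a b (by omega) h

theorem lcancel (x a b : M N) : x * a = x * b → a = b := by
  induction x using M_ind with
  | h1 => simp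
  | h2 i x ih =>
    intro h
    rw [mul_assoc, mul_assoc] at h
    exact ih ((gar_all N (len (x * a) + 1)).cancel (by omega) h)

/-- reversal -/
theorem exists_rev (N : ℕ) : ∃ r : M N → M N, (∀ x y, r (x * y) = r y * r x) ∧ (∀ x, r (r x) = x) := by
  refine ⟨Quotient.map List.reverse (fun _ _ h => BEqv.reverse h), ?_, ?_⟩
  · rintro ⟨a⟩ ⟨b⟩
    exact congrArg mk (List.reverse_append)
  · rintro ⟨a⟩
    exact congrArg mk (List.reverse_reverse a)

theorem rcancel (x a b : M N) (h : a * x = b * x) : a = b := by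
  obtain ⟨r, h1, h2⟩ := exists_rev N
  have := congrArg r h
  rw [h1, h1] at this
  rw [← h2 a, ← h2 b, lcancel _ _ _ this]

theorem dvd_cancel {x a b : M N} (h : x * a ∣ x * b) : a ∣ b := by
  obtain ⟨c, hc⟩ := h
  rw [mul_assoc] at hc
  exact ⟨c, lcancel _ _ _ hc⟩

/-- Existence of right lcms for elements with a common right multiple. -/
theorem lcm_exists (L : ℕ) : ∀ (n u v : M N), len n ≤ L → u ∣ n → v ∣ n →
    ∃ m, u ∣ m ∧ v ∣ m ∧ ∀ x, u ∣ x → v ∣ x → m ∣ x := by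
  induction L with
  | zero =>
    rintro n u v hn ⟨a, rfl⟩ hv
    simp only [len_mul] at hn
    have hu := eq_one_of_len (x := u) (by omega)
    subst hu
    exact ⟨v, one_dvd _, dvd_rfl, fun x _ h => h⟩
  | succ L ih =>
    intro n u v hn hu hv
    induction u using M_ind with
    | h1 => exact ⟨v, one_dvd _, dvd_rfl, fun x _ h => h⟩
    | h2 i u _ =>
    induction v using M_ind with
    | h1 => exact ⟨g i * u, dvd_rfl, one_dvd _, fun x h _ => h⟩
    | h2 j v _ =>
    obtain ⟨a, ha⟩ := hu
    obtain ⟨b, hb⟩ := hv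
    rw [mul_assoc] at ha hb
    obtain ⟨w, e1, e2⟩ := gar i j _ _ (ha.symm.trans hb)
    have l1 := congrArg len ha
    have l2 := congrArg len hb
    have l3 := congrArg len e1
    simp only [len_mul, len_g] at l1 l2 l3
    obtain ⟨m1, p1, ⟨p, rfl⟩, r1⟩ := ih (u * a) u (C i j) (by simp; omega) ⟨a, rfl⟩ ⟨w, e1⟩
    obtain ⟨m2, p2, ⟨q, rfl⟩, r2⟩ := ih (v * b) v (C j i) (by simp; omega) ⟨b, rfl⟩ ⟨w, e2⟩
    have hp : p ∣ w := dvd_cancel (x := C i j) (r1 _ ⟨a, e1.symm⟩ ⟨w, rfl⟩)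
    have hq : q ∣ w := dvd_cancel (x := C j i) (r2 _ ⟨b, e2.symm⟩ ⟨w, rfl⟩)
    obtain ⟨m, s1, s2, s3⟩ := ih w p q (by omega) hp hq
    refine ⟨g i * (C i j * m), ?_, ?_, ?_⟩
    · exact mul_dvd_mul_left _ (p1.trans (mul_dvd_mul_left _ s1))
    · rw [← mul_assoc, C_eq, mul_assoc]
      exact mul_dvd_mul_left _ (p2.trans (mul_dvd_mul_left _ s2))
    · rintro x ⟨a', ha'⟩ ⟨b', hb'⟩
      rw [mul_assoc] at ha' hb'
      obtain ⟨w', f1, f2⟩ := gar i j _ _ (ha'.symm.trans hb')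
      have hp' : p ∣ w' := dvd_cancel (x := C i j) (r1 _ ⟨a', f1.symm⟩ ⟨w', rfl⟩)
      have hq' : q ∣ w' := dvd_cancel (x := C j i) (r2 _ ⟨b', f2.symm⟩ ⟨w', rfl⟩)
      rw [ha', f1]
      have hmw := s3 _ hp' hq'
      exact mul_dvd_mul_left _ (mul_dvd_mul_left _ hmw)

/-- Total indexing of generators by naturals. -/
def s (N : ℕ) (k : ℕ) : M N := if h : k < N then g ⟨k, h⟩ else 1

theorem sfar {i j : ℕ} (h : i + 2 ≤ j) : s N i * s N j = s N j * s N i := by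
  unfold s
  by_cases hj : j < N
  · have hi : i < N := by omega
    rw [dif_pos hj, dif_pos hi]
    have := gfar (N := N) (i := ⟨i, hi⟩) (j := ⟨j, hj⟩) (by simp; omega)
      (by unfold Adj; simp; omega) 1
    simpa using this
  · rw [dif_neg hj]; simp

theorem sadj {i : ℕ} (h : i + 1 < N) :
    s N i * (s N (i + 1) * s N i) = s N (i + 1) * (s N i * s N (i + 1)) := by
  unfold s
  have hi : i < N := by omega
  rw [dif_pos h, dif_pos hi]
  have := gadj (N := N) (i := ⟨i, hi⟩) (j := ⟨i + 1, h⟩) (by unfold Adj; simp) 1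
  simpa using this

/-- `σ_0 ⋯ σ_{m-1}`. -/
def pi (N m : ℕ) : M N := ((List.range m).map (s N)).prod

theorem pi_succ (m : ℕ) : pi N (m + 1) = pi N m * s N m := by
  simp [pi, List.range_succ]

theorem pi_zero : pi N 0 = 1 := by simp [pi]

/-- Garside element. -/
def dl (N : ℕ) : ℕ → M N
  | 0 => 1
  | m + 1 => pi N m * dl N m

theorem pi_comm {m i : ℕ} (h : m + 1 ≤ i) : s N i * pi N m = pi N m * s N i := by
  induction m with
  | zero => simp [pi_zero]
  | succ m ih =>
    rw [pi_succ, ← mul_assoc, ih (by omega), mul_assoc, mul_assoc, sfar (i := m) (j := i) (by omega)]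

theorem dl_comm {m i : ℕ} (h : m ≤ i) : s N i * dl N m = dl N m * s N i := by
  induction m with
  | zero => simp [dl]
  | succ m ih =>
    rw [dl, ← mul_assoc, pi_comm h, mul_assoc, mul_assoc, ih (by omega)]

theorem pi_shift {m i : ℕ} (h : i + 1 < m) (hm : m ≤ N) :
    s N (i + 1) * pi N m = pi N m * s N i := by
  induction m with
  | zero => omega
  | succ m ih =>
    by_cases hi : i + 1 < m
    · rw [pi_succ, ← mul_assoc, ih hi (by omega), mul_assoc, mul_assoc,
        sfar (i := i) (j := m) (by omega)]
    · obtain rfl : m = i + 1 := by omega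
      rw [pi_succ, pi_succ]
      simp only [← mul_assoc]
      rw [pi_comm (by omega)]
      simp only [mul_assoc]
      rw [sadj (by omega)]

theorem pi_shift' {p : ℕ} (hp : p + 1 ≤ N) (q : ℕ) (hq : q ≤ p) :
    ((List.range q).map (fun k => s N (k + 1))).prod * pi N (p + 1) = pi N (p + 1) * pi N q := by
  induction q with
  | zero => simp [pi_zero]
  | succ q ih =>
    rw [List.range_succ, pi_succ q]
    simp only [List.map_append, List.prod_append, List.map_cons, List.map_nil, List.prod_singleton]
    rw [mul_assoc, pi_shift (by omega) hp, ← mul_assoc, ih (by omega), mul_assoc]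

theorem pi_sq {p : ℕ} (hp : p + 1 ≤ N) :
    s N 0 * (pi N (p + 1) * pi N p) = pi N (p + 1) * (pi N p * s N p) := by
  rw [← pi_succ, ← pi_shift' hp p le_rfl, ← mul_assoc]
  congr 1
  simp [pi, List.range_succ_eq_map, List.map_map, Function.comp_def]

theorem dl_quasi {m : ℕ} (hm : m ≤ N + 1) : ∀ i, i + 2 ≤ m →
    s N i * dl N m = dl N m * s N (m - 2 - i) := by
  induction m with
  | zero => intro i h; omega
  | succ m ih =>
    intro i hi
    cases i with
    | succ i =>
      rw [dl, ← mul_assoc, pi_shift (by omega) (by omega), mul_assoc, ih (by omega) i (by omega),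
        mul_assoc]
      congr 3
      omega
    | zero =>
      obtain ⟨p, rfl⟩ : ∃ p, m = p + 1 := ⟨m - 1, by omega⟩
      have : p + 1 + 1 - 2 - 0 = p := by omega
      rw [this, dl, dl, mul_assoc, mul_assoc, ← dl_comm le_rfl]
      rw [← mul_assoc (pi N (p+1)), ← mul_assoc (s N 0), pi_sq (by omega)]
      simp only [mul_assoc]

theorem s_dvd_dl {m : ℕ} (hm : m ≤ N + 1) : ∀ i, i + 2 ≤ m → s N i ∣ dl N m := by
  induction m with
  | zero => intro i h; omega
  | succ m ih =>
    intro i hi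
    cases i with
    | succ i =>
      obtain ⟨w, hw⟩ := ih (by omega) i (by omega)
      refine ⟨pi N m * w, ?_⟩
      rw [dl, hw, ← mul_assoc, ← mul_assoc, pi_shift (by omega) (by omega)]
    | zero =>
      obtain ⟨p, rfl⟩ : ∃ p, m = p + 1 := ⟨m - 1, by omega⟩
      rw [dl]
      refine Dvd.dvd.mul_right ?_ _
      simp [pi, List.range_succ_eq_map]

/-- The Garside element of `M N`. -/
def D (N : ℕ) : M N := dl N (N + 1)

theorem s_fin (i : Fin N) : s N i = g i := by simp [s]

theorem g_dvd_D (i : Fin N) : g i ∣ D N := by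
  rw [← s_fin]; exact s_dvd_dl le_rfl _ (by omega)

theorem D_dvd (x : M N) : D N ∣ x * D N := by
  induction x using M_ind with
  | h1 => simp
  | h2 i x ih =>
    obtain ⟨c, hc⟩ := ih
    rw [mul_assoc, hc, ← mul_assoc, ← s_fin, D, dl_quasi le_rfl _ (by omega), mul_assoc]
    exact ⟨_, rfl⟩

theorem common_right (u v : M N) : ∃ p q, u * p = v * q := by
  induction u using M_ind generalizing v with
  | h1 => exact ⟨v, 1, by simp⟩
  | h2 i u ih =>
    obtain ⟨p, hp⟩ := (g_dvd_D i).trans (D_dvd v)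
    obtain ⟨a, b, hab⟩ := ih p
    refine ⟨a, D N * b, ?_⟩
    rw [mul_assoc, hab, ← mul_assoc, ← hp, mul_assoc]

theorem common_left (u v : M N) : ∃ p q, p * u = q * v := by
  obtain ⟨r, h1, h2⟩ := exists_rev N
  obtain ⟨p, q, h⟩ := common_right (r u) (r v)
  refine ⟨r p, r q, ?_⟩
  have := congrArg r h
  rwa [h1, h1, h2, h2] at this

/-- Key step for one generator. -/
theorem key_gen {t : M N} (ht : t ∣ D N) (i : Fin N) (y : M N) (h : t ∣ g i * y) :
    ∃ t', t' ∣ D N ∧ t' ∣ y ∧ t ∣ g i * t' := by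
  obtain ⟨m, h1, ⟨t', rfl⟩, h3⟩ := lcm_exists _ (g i * y) t (g i) le_rfl h (dvd_mul_right _ _)
  exact ⟨t', dvd_cancel (h3 _ (ht.trans (D_dvd _)) (dvd_mul_right _ _)),
    dvd_cancel (h3 _ h (dvd_mul_right _ _)), h1⟩

theorem key {y b : M N} (hb : ∀ d, d ∣ y → d ∣ D N → d ∣ b) (x : M N) :
    ∀ t, t ∣ D N → t ∣ x * y → t ∣ x * b := by
  induction x using M_ind with
  | h1 => intro t ht h; rw [one_mul] at *; exact hb t h ht
  | h2 i x ih =>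
    intro t ht h
    rw [mul_assoc] at *
    obtain ⟨t', a1, a2, a3⟩ := key_gen ht i _ h
    exact a3.trans (mul_dvd_mul_left _ (ih t' a1 a2))

theorem M_antisymm {a b : M N} (h : a ∣ b) (h' : b ∣ a) : a = b := by
  obtain ⟨c, rfl⟩ := h
  obtain ⟨d, hd⟩ := h'
  have := congrArg len hd
  simp only [len_mul] at this
  rw [eq_one_of_len (x := c) (by omega), mul_one]

/-- The Ore structure. -/
noncomputable instance oreTop : OreLocalization.OreSet (⊤ : Submonoid (M N)) where
  ore_right_cancel a b c h := ⟨1, by rw [rcancel _ _ _ h]⟩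
  oreNum r c := (common_left r c).choose_spec.choose
  oreDenom r c := ⟨(common_left r c).choose, trivial⟩
  ore_eq r c := (common_left r c).choose_spec.choose_spec

/-- Group into which `M N` embeds. -/
abbrev Fr (N : ℕ) := (OreLocalization (⊤ : Submonoid (M N)) (M N))ˣ

/-- Embedding. -/
noncomputable def em (N : ℕ) (x : M N) : Fr N :=
  OreLocalization.numeratorUnit (⟨x, trivial⟩ : (⊤ : Submonoid (M N)))

theorem em_val (x : M N) : (em N x : OreLocalization (⊤ : Submonoid (M N)) (M N)) =
  OreLocalization.numeratorHom x := rfl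

theorem em_mul (x y : M N) : em N (x * y) = em N x * em N y := by
  apply Units.ext
  rw [Units.val_mul, em_val, em_val, em_val, map_mul]

theorem em_one : em N 1 = 1 := by
  apply Units.ext
  rw [em_val, map_one, Units.val_one]

theorem em_inj {x y : M N} (h : em N x = em N y) : x = y := by
  have h' := congrArg Units.val h
  rw [em_val, em_val, OreLocalization.numeratorHom_apply, OreLocalization.numeratorHom_apply,
    OreLocalization.oreDiv_eq_iff] at h'
  obtain ⟨u, v, h1, h2⟩ := h'
  have h3 : (u : M N) = v := by simpa using h2
  have h4 : (u : M N) * y = v * x := h1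
  rw [← h3] at h4
  exact (lcancel _ _ _ h4).symm

theorem gen_far {n : ℕ} {i j : Fin (n - 1)} (h : i ≠ j) (h' : ¬ Adj i j) :
    (braidGen i : BraidGroup n) * braidGen j = braidGen j * braidGen i := by
  have main : ∀ i j : Fin (n - 1), (i : ℕ) + 2 ≤ j →
      (braidGen i : BraidGroup n) * braidGen j = braidGen j * braidGen i := by
    intro i j hij
    have := PresentedGroup.one_of_mem (rels := braidRels n) (Or.inl ⟨i, j, hij, rfl⟩)
    rw [map_mul, map_inv, mul_inv_eq_one] at this
    exact this
  have h0 : (i : ℕ) ≠ j := fun q => h (Fin.ext q)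
  unfold Adj at h'
  rcases lt_or_gt_of_ne h0 with q | q
  · exact main i j (by omega)
  · exact (main j i (by omega)).symm

theorem gen_adj {n : ℕ} {i j : Fin (n - 1)} (h : Adj i j) :
    (braidGen i : BraidGroup n) * braidGen j * braidGen i =
      braidGen j * braidGen i * braidGen j := by
  have main : ∀ i j : Fin (n - 1), (i : ℕ) + 1 = j →
      (braidGen i : BraidGroup n) * braidGen j * braidGen i =
      braidGen j * braidGen i * braidGen j := by
    intro i j hij
    have := PresentedGroup.one_of_mem (rels := braidRels n) (Or.inr ⟨i, j, hij, rfl⟩)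
    rw [map_mul, map_inv, mul_inv_eq_one] at this
    exact this
  rcases h with q | q
  · exact main i j q
  · exact (main j i q).symm

/-- The map of `M (n-1)` to the braid group. -/
def phi (n : ℕ) : M (n - 1) →* BraidGroup n where
  toFun := Quotient.lift (fun u => (u.map (braidGen (n := n))).prod) (by
    intro u v h
    replace h : BEqv u v := h
    induction h with
    | refl u => rfl
    | symm h ih => exact ih.symm
    | trans h1 h2 a b => exact a.trans b
    | cons i h ih => simp only [List.map_cons, List.prod_cons]; rw [ih]
    | far u h1 h2 =>
      simp only [List.map_cons, List.prod_cons, ← mul_assoc]; rw [gen_far h1 h2]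
    | adj u h1 =>
      simp only [List.map_cons, List.prod_cons, ← mul_assoc]; rw [gen_adj h1])
  map_one' := rfl
  map_mul' := by
    rintro ⟨u⟩ ⟨v⟩
    show ((u ++ v).map (braidGen (n := n))).prod = _
    rw [List.map_append, List.prod_append]

theorem phi_g {n : ℕ} (i : Fin (n - 1)) : phi n (g i) = braidGen i := by
  show ([i].map (braidGen (n := n))).prod = _
  simp

theorem exists_psi (n : ℕ) : ∃ psi : BraidGroup n →* Fr (n - 1),
    ∀ i, psi (braidGen i) = em (n - 1) (g i) := by
  have hr : ∀ r ∈ braidRels n, FreeGroup.lift (fun i => em (n - 1) (g i)) r = 1 := by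
    rintro r (⟨i, j, hij, rfl⟩ | ⟨i, j, hij, rfl⟩)
    · rw [map_mul, map_inv, mul_inv_eq_one]
      simp only [map_mul, FreeGroup.lift_apply_of, ← em_mul]
      congr 1
      simpa using gfar (i := i) (j := j) (by rintro rfl; omega) (by unfold Adj; omega) 1
    · rw [map_mul, map_inv, mul_inv_eq_one]
      simp only [map_mul, FreeGroup.lift_apply_of, ← em_mul]
      congr 1
      simpa [mul_assoc] using gadj (i := i) (j := j) (Or.inl hij) 1
  exact ⟨PresentedGroup.toGroup hr, fun i => PresentedGroup.toGroup.of hr⟩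

theorem phi_inj (n : ℕ) {x y : M (n - 1)} (h : phi n x = phi n y) : x = y := by
  obtain ⟨psi, hpsi⟩ := exists_psi n
  have : ∀ x : M (n - 1), psi (phi n x) = em (n - 1) x := by
    intro x
    induction x using M_ind with
    | h1 => simp [em_one]
    | h2 i x ih => rw [map_mul, map_mul, phi_g, hpsi, ih, em_mul]
  apply em_inj
  rw [← this, ← this, h]

theorem mem_iff {n : ℕ} {x : BraidGroup n} : x ∈ PosBraid n ↔ ∃ u, phi n u = x := by
  constructor
  · intro h
    have : PosBraid n ≤ MonoidHom.mrange (phi n) := by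
      unfold PosBraid
      rw [Submonoid.closure_le]
      rintro _ ⟨i, rfl⟩
      exact ⟨g i, phi_g i⟩
    exact this h
  · rintro ⟨u, rfl⟩
    induction u using M_ind with
    | h1 => rw [map_one]; exact one_mem _
    | h2 i x ih =>
      rw [map_mul, phi_g]
      exact mul_mem (Submonoid.subset_closure ⟨i, rfl⟩) ih

theorem dvd_iff {n : ℕ} {x y : M (n - 1)} : DividesL (phi n x) (phi n y) ↔ x ∣ y := by
  constructor
  · rintro ⟨z, hz, h⟩
    obtain ⟨w, rfl⟩ := mem_iff.1 hz
    rw [← map_mul] at h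
    exact ⟨w, phi_inj n h⟩
  · rintro ⟨w, rfl⟩
    exact ⟨phi n w, mem_iff.2 ⟨w, rfl⟩, map_mul _ _ _⟩

theorem phi_dl (n m : ℕ) : phi n (dl (n - 1) m) = deltaAux n m := by
  induction m with
  | zero => rw [dl, deltaAux, map_one]
  | succ m ih =>
    rw [dl, deltaAux, map_mul, ih, pi, map_list_prod, List.map_map]
    congr 3
    funext k
    simp only [Function.comp, s]
    split_ifs
    · rw [phi_g]
    · rw [map_one]

theorem phi_D (n : ℕ) : phi n (D (n - 1)) = braidDelta n := by
  unfold D braidDelta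
  rcases n with _ | n
  · rw [phi_dl]; simp [deltaAux]
  · exact phi_dl (n + 1) (n + 1)

end BraidAux

/-- For positive braids `x, y` and `α(x) = gcd_L(x, Δ_n)` : `α(xy) = α(x·α(y))`. -/
theorem alpha_mul (n : ℕ) (x y a b c : BraidGroup n)
    (hx : x ∈ PosBraid n) (hy : y ∈ PosBraid n)
    (hb : IsLeftGcd b y (braidDelta n))
    (ha : IsLeftGcd a (x * y) (braidDelta n))
    (hc : IsLeftGcd c (x * b) (braidDelta n)) :
    a = c := by
  obtain ⟨hb0, hb1, hb2, hb3⟩ := hb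
  obtain ⟨ha0, ha1, ha2, ha3⟩ := ha
  obtain ⟨hc0, hc1, hc2, hc3⟩ := hc
  obtain ⟨x, rfl⟩ := BraidAux.mem_iff.1 hx
  obtain ⟨y, rfl⟩ := BraidAux.mem_iff.1 hy
  obtain ⟨a, rfl⟩ := BraidAux.mem_iff.1 ha0
  obtain ⟨b, rfl⟩ := BraidAux.mem_iff.1 hb0
  obtain ⟨c, rfl⟩ := BraidAux.mem_iff.1 hc0
  simp only [← map_mul, ← BraidAux.phi_D, BraidAux.dvd_iff] at *
  congr 1
  apply BraidAux.M_antisymm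
  · refine BraidAux.dvd_iff.1 (hc3 _ ha0 (BraidAux.dvd_iff.2 ?_) (BraidAux.dvd_iff.2 ha2))
    refine BraidAux.key (fun d h1 h2 => ?_) x a ha2 ha1
    exact BraidAux.dvd_iff.1 (hb3 _ (BraidAux.mem_iff.2 ⟨d, rfl⟩) (BraidAux.dvd_iff.2 h1)
      (BraidAux.dvd_iff.2 h2))
  · refine BraidAux.dvd_iff.1 (ha3 _ hc0 (BraidAux.dvd_iff.2 ?_) (BraidAux.dvd_iff.2 hc2))
    exact hc1.trans (mul_dvd_mul_left _ hb1)
end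

section
/- For simple n-braids s and t, the pair (s, t) is normal if and only if gcd_L(s*, t) = 1, where s* is the unique simple braid satisfying s·s* = Δ_n. -/
/-! ### The abstract positive braid monoid -/

namespace PBM

/-- Adjacent indices. -/
def Adj {N : ℕ} (i j : Fin N) : Prop := (i : ℕ) + 1 = j ∨ (j : ℕ) + 1 = i

/-- Commuting indices. -/
def Far {N : ℕ} (i j : Fin N) : Prop := (i : ℕ) + 2 ≤ j ∨ (j : ℕ) + 2 ≤ i

theorem Adj.symm {N : ℕ} {i j : Fin N} (h : Adj i j) : Adj j i := Or.symm h
theorem Far.symm {N : ℕ} {i j : Fin N} (h : Far i j) : Far j i := Or.symm h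

/-- The braid relations on the free monoid. -/
inductive BRel (N : ℕ) : FreeMonoid (Fin N) → FreeMonoid (Fin N) → Prop
  | far (i j : Fin N) (h : Far i j) :
      BRel N (FreeMonoid.of i * FreeMonoid.of j) (FreeMonoid.of j * FreeMonoid.of i)
  | adj (i j : Fin N) (h : Adj i j) :
      BRel N (FreeMonoid.of i * FreeMonoid.of j * FreeMonoid.of i)
        (FreeMonoid.of j * FreeMonoid.of i * FreeMonoid.of j)

/-- The abstract positive braid monoid. -/
abbrev M (N : ℕ) := PresentedMonoid (BRel N)

variable {N : ℕ}

/-- generators -/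
def s (i : Fin N) : M N := PresentedMonoid.of (BRel N) i

theorem cm0 {i j : Fin N} (h : Far i j) : s i * s j = s j * s i :=
  PresentedMonoid.mk_eq_mk_of_rel (BRel.far i j h)

theorem br0 {i j : Fin N} (h : Adj i j) : s i * s j * s i = s j * s i * s j :=
  PresentedMonoid.mk_eq_mk_of_rel (BRel.adj i j h)

theorem cm {i j : Fin N} (h : Far i j) (w : M N) : s i * (s j * w) = s j * (s i * w) := by
  rw [← mul_assoc, cm0 h, mul_assoc]

theorem br {i j : Fin N} (h : Adj i j) (w : M N) :
    s i * (s j * (s i * w)) = s j * (s i * (s j * w)) := by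
  have := congrArg (· * w) (br0 h)
  simpa only [mul_assoc] using this

/-- length homomorphism -/
def lenHom (N : ℕ) : M N →* Multiplicative ℕ :=
  PresentedMonoid.lift (fun _ => Multiplicative.ofAdd 1) (by
    intro a b h
    cases h <;> simp)

/-- length -/
def len (x : M N) : ℕ := (lenHom N x).toAdd

@[simp] theorem len_mul (x y : M N) : len (x * y) = len x + len y := by
  simp [len]

@[simp] theorem len_one : len (1 : M N) = 0 := by
  simp [len]

@[simp] theorem len_s (i : Fin N) : len (s i) = 1 := rfl

theorem len_mk (x : FreeMonoid (Fin N)) :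
    len (PresentedMonoid.mk (BRel N) x) = x.length := by
  induction x using FreeMonoid.inductionOn' with
  | one => simp
  | of_mul a x ih =>
    rw [map_mul, len_mul, ih, FreeMonoid.length_mul, FreeMonoid.length_of]
    congr 1

theorem M.cases (x : M N) : x = 1 ∨ ∃ i y, x = s i * y := by
  obtain ⟨a, rfl⟩ := PresentedMonoid.surjective_mk x
  cases a using FreeMonoid.casesOn with
  | one => left; exact map_one _
  | of_mul i a => right; exact ⟨i, PresentedMonoid.mk (BRel N) a, map_mul _ _ _⟩

theorem M.ind {P : M N → Prop} (x : M N) (h1 : P 1) (h : ∀ i y, P y → P (s i * y)) : P x := by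
  obtain ⟨a, rfl⟩ := PresentedMonoid.surjective_mk x
  induction a using FreeMonoid.inductionOn' with
  | one => rw [map_one]; exact h1
  | of_mul i a ih => rw [map_mul]; exact h _ _ ih

/-- The lcm property. -/
def Kp (i j : Fin N) (a b : M N) : Prop :=
  (i = j ∧ a = b) ∨ (Far i j ∧ ∃ w, a = s j * w ∧ b = s i * w) ∨
    (Adj i j ∧ ∃ w, a = s j * (s i * w) ∧ b = s i * (s j * w))

theorem Kp.symm {i j : Fin N} {a b : M N} (h : Kp i j a b) : Kp j i b a := by
  rcases h with ⟨h, h'⟩ | ⟨h, w, h1, h2⟩ | ⟨h, w, h1, h2⟩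
  · exact Or.inl ⟨h.symm, h'.symm⟩
  · exact Or.inr (Or.inl ⟨h.symm, w, h2, h1⟩)
  · exact Or.inr (Or.inr ⟨h.symm, w, h2, h1⟩)

theorem Kp.mul {i j : Fin N} {a b : M N} (h : Kp i j a b) (c : M N) :
    Kp i j (a * c) (b * c) := by
  rcases h with ⟨h, h'⟩ | ⟨h, w, h1, h2⟩ | ⟨h, w, h1, h2⟩
  · exact Or.inl ⟨h, by rw [h']⟩
  · exact Or.inr (Or.inl ⟨h, w * c, by rw [h1]; simp only [mul_assoc],
      by rw [h2]; simp only [mul_assoc]⟩)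
  · exact Or.inr (Or.inr ⟨h, w * c, by rw [h1]; simp only [mul_assoc],
      by rw [h2]; simp only [mul_assoc]⟩)

theorem trich (i j : Fin N) : i = j ∨ Far i j ∨ Adj i j := by
  unfold Far Adj; rw [Fin.ext_iff]; omega

theorem Far.not_adj {i j : Fin N} (h : Far i j) : ¬ Adj i j := by
  unfold Far at h; unfold Adj; omega
theorem Far.ne {i j : Fin N} (h : Far i j) : i ≠ j := by
  rintro rfl; unfold Far at h; omega
theorem Adj.ne {i j : Fin N} (h : Adj i j) : i ≠ j := by
  rintro rfl; unfold Adj at h; omega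

/-- The induction hypothesis. -/
def IH (N L : ℕ) : Prop :=
  ∀ (i j : Fin N) (a b : M N), len a < L → s i * a = s j * b → Kp i j a b

theorem IH.far {L : ℕ} (H : IH N L) {i j : Fin N} {a b : M N} (h : Far i j) (hl : len a < L)
    (e : s i * a = s j * b) : ∃ w, a = s j * w ∧ b = s i * w := by
  rcases H i j a b hl e with ⟨h', _⟩ | ⟨_, h'⟩ | ⟨h', _⟩
  · exact absurd h' h.ne
  · exact h'
  · exact absurd h' h.not_adj

theorem IH.adj {L : ℕ} (H : IH N L) {i j : Fin N} {a b : M N} (h : Adj i j) (hl : len a < L)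
    (e : s i * a = s j * b) : ∃ w, a = s j * (s i * w) ∧ b = s i * (s j * w) := by
  rcases H i j a b hl e with ⟨h', _⟩ | ⟨h', _⟩ | ⟨_, h'⟩
  · exact absurd h' h.ne
  · exact absurd h h'.not_adj
  · exact h'

theorem IH.canc {L : ℕ} (H : IH N L) {i : Fin N} {a b : M N} (hl : len a < L)
    (e : s i * a = s i * b) : a = b := by
  rcases H i i a b hl e with ⟨_, h'⟩ | ⟨h', _⟩ | ⟨h', _⟩
  · exact h'
  · exact absurd rfl h'.ne
  · exact absurd rfl h'.ne

/-- mixed case: `k` far from `i`, adjacent to `j`. -/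
theorem mixed {L : ℕ} (H : IH N L) {i j k : Fin N} {w1 w2 : M N}
    (hki : Far k i) (hkj : Adj k j) (hl : len w1 < L)
    (e : s i * w1 = s j * (s k * w2)) : Kp i j (s k * w1) (s k * (s j * w2)) := by
  have hl0 := congrArg len e
  simp only [len_mul, len_s] at hl0
  rcases trich i j with rfl | hij | hij
  · exact absurd hkj hki.not_adj
  · obtain ⟨w3, rfl, e2⟩ := H.far hij hl e
    obtain ⟨w4, rfl, rfl⟩ := H.far hki (by omega) e2
    refine Or.inr (Or.inl ⟨hij, s k * (s j * w4), ?_, ?_⟩)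
    · exact br hkj w4
    · rw [← cm hij, cm hki]
  · obtain ⟨w3, rfl, e2⟩ := H.adj hij hl e
    simp only [len_mul, len_s] at hl hl0
    obtain ⟨w4, rfl, e3⟩ := H.far hki (by omega) e2
    simp only [len_mul, len_s] at hl hl0
    obtain ⟨w5, rfl, rfl⟩ := H.adj hkj.symm (by omega) e3
    refine Or.inr (Or.inr ⟨hij, s k * (s j * (s i * w5)), ?_, ?_⟩)
    · rw [← cm hki, br hkj, ← br hij, cm hki]
    · rw [← br hij, cm hki, ← cm hki w5, br hkj]

theorem Kp.trans {L : ℕ} (H : IH N L) {i j k : Fin N} {a m b : M N}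
    (hm : len m ≤ L) (h1 : Kp i k a m) (h2 : Kp k j m b) : Kp i j a b := by
  rcases h1 with ⟨rfl, rfl⟩ | ⟨hik, w1, rfl, rfl⟩ | ⟨hik, w1, rfl, rfl⟩
  · exact h2
  · rcases h2 with ⟨rfl, rfl⟩ | ⟨hkj, w2, e, rfl⟩ | ⟨hkj, w2, e, rfl⟩
    · exact Or.inr (Or.inl ⟨hik, w1, rfl, rfl⟩)
    · simp only [len_mul, len_s] at hm
      rcases H i j w1 w2 (by omega) e with ⟨rfl, rfl⟩ | ⟨hij, w, rfl, rfl⟩ | ⟨hij, w, rfl, rfl⟩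
      · exact Or.inl ⟨rfl, rfl⟩
      · exact Or.inr (Or.inl ⟨hij, s k * w, cm hkj w, cm hik.symm w⟩)
      · refine Or.inr (Or.inr ⟨hij, s k * w, ?_, ?_⟩)
        · rw [cm hkj, cm hik.symm]
        · rw [cm hik.symm, cm hkj]
    · simp only [len_mul, len_s] at hm
      exact mixed H hik.symm hkj (by omega) e
  · rcases h2 with ⟨rfl, rfl⟩ | ⟨hkj, w2, e, rfl⟩ | ⟨hkj, w2, e, rfl⟩
    · exact Or.inr (Or.inr ⟨hik, w1, rfl, rfl⟩)
    · have hl0 := congrArg len e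
      simp only [len_mul, len_s] at hm hl0
      exact (mixed H hkj hik.symm (by omega) e.symm).symm
    · have hl0 := congrArg len e
      simp only [len_mul, len_s] at hm hl0
      rcases trich i j with rfl | hij | hij
      · have e1 := H.canc (by simp only [len_mul, len_s]; omega) e
        have e2 := H.canc (by omega) e1
        subst e2
        exact Or.inl ⟨rfl, rfl⟩
      · obtain ⟨w3, e1, e2⟩ := H.far hij (by simp only [len_mul, len_s]; omega) e
        obtain ⟨w4, rfl, rfl⟩ := H.adj hkj (by omega) e1
        simp only [len_mul, len_s] at hm hl0
        obtain ⟨w5, rfl, e3⟩ := H.adj hik.symm (by omega) e2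
        simp only [len_mul, len_s] at hm hl0
        have e4 := H.canc (by simp only [len_mul, len_s]; omega) e3
        obtain ⟨w6, rfl, rfl⟩ := H.far hij.symm (by omega) e4
        refine Or.inr (Or.inl ⟨hij, s k * (s j * (s i * (s k * w6))), ?_, ?_⟩)
        · rw [cm hij, br hik, br hkj]
        · rw [cm hij.symm, br hkj.symm, br hik.symm, cm hij]
      · exfalso
        unfold Adj at hij hik hkj; omega

theorem rel_len {x y : FreeMonoid (Fin N)} (h : ConGen.Rel (BRel N) x y) :
    x.length = y.length := by
  rw [← len_mk, ← len_mk]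
  congr 1
  exact PresentedMonoid.mk_eq_mk_iff.2 h

theorem of_mul_inj {i j : Fin N} {a b : FreeMonoid (Fin N)}
    (h : FreeMonoid.of i * a = FreeMonoid.of j * b) : i = j ∧ a = b := by
  have := congrArg FreeMonoid.toList h
  simpa using this

theorem one_ne_of_mul {i : Fin N} {a : FreeMonoid (Fin N)} (h : 1 = FreeMonoid.of i * a) :
    False := by
  have := congrArg FreeMonoid.length h
  simp at this
  omega

theorem key_rel {L : ℕ} (H : IH N L) {x y : FreeMonoid (Fin N)} (h : ConGen.Rel (BRel N) x y) :
    ∀ i j a b, x = FreeMonoid.of i * a → y = FreeMonoid.of j * b → a.length ≤ L →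
      Kp i j (PresentedMonoid.mk (BRel N) a) (PresentedMonoid.mk (BRel N) b) := by
  induction h with
  | of x y h =>
    intro i j a b hx hy _
    cases h with
    | far p q h =>
      obtain ⟨rfl, rfl⟩ := of_mul_inj hx
      obtain ⟨rfl, rfl⟩ := of_mul_inj hy
      exact Or.inr (Or.inl ⟨h, 1, (mul_one _).symm, (mul_one _).symm⟩)
    | adj p q h =>
      rw [mul_assoc] at hx hy
      obtain ⟨rfl, rfl⟩ := of_mul_inj hx
      obtain ⟨rfl, rfl⟩ := of_mul_inj hy
      exact Or.inr (Or.inr ⟨h, 1, by rw [mul_one]; rfl, by rw [mul_one]; rfl⟩)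
  | refl x =>
    intro i j a b hx hy _
    obtain ⟨rfl, rfl⟩ := of_mul_inj (hx.symm.trans hy)
    exact Or.inl ⟨rfl, rfl⟩
  | symm h ih =>
    intro i j a b hx hy hl
    refine (ih j i b a hy hx ?_).symm
    have := rel_len h
    rw [hx, hy] at this
    simp at this
    omega
  | @trans x z y h1 h2 ih1 ih2 =>
    intro i j a b hx hy hl
    have l1 := rel_len h1
    rw [hx] at l1
    cases z using FreeMonoid.casesOn with
    | one => simp at l1
    | of_mul k m =>
      simp at l1
      refine Kp.trans H ?_ (ih1 i k a m hx rfl hl) (ih2 k j m b rfl hy (by omega))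
      rw [len_mk]; omega
  | @mul w x y z h1 h2 ih1 ih2 =>
    intro i j a b hx hy hl
    have l1 := rel_len h1
    cases w using FreeMonoid.casesOn with
    | one =>
      cases x using FreeMonoid.casesOn with
      | one =>
        rw [one_mul] at hx hy
        exact ih2 i j a b hx hy hl
      | of_mul k m => simp at l1; omega
    | of_mul k m =>
      cases x using FreeMonoid.casesOn with
      | one => simp at l1
      | of_mul k' m' =>
        rw [mul_assoc] at hx hy
        obtain ⟨rfl, rfl⟩ := of_mul_inj hx
        obtain ⟨rfl, rfl⟩ := of_mul_inj hy
        have e : PresentedMonoid.mk (BRel N) y = PresentedMonoid.mk (BRel N) z :=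
          PresentedMonoid.mk_eq_mk_iff.2 h2
        rw [map_mul, map_mul, e]
        refine (ih1 _ _ _ _ rfl rfl ?_).mul _
        rw [FreeMonoid.length_mul] at hl
        omega

theorem IH_all (N L : ℕ) : IH N L := by
  induction L with
  | zero => intro i j a b h; omega
  | succ L H =>
    intro i j a b hl e
    obtain ⟨a, rfl⟩ := PresentedMonoid.surjective_mk a
    obtain ⟨b, rfl⟩ := PresentedMonoid.surjective_mk b
    rw [len_mk] at hl
    exact key_rel H (PresentedMonoid.mk_eq_mk_iff.1
      (show PresentedMonoid.mk (BRel N) (FreeMonoid.of i * a) =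
        PresentedMonoid.mk (BRel N) (FreeMonoid.of j * b) from e)) i j a b rfl rfl (by omega)

theorem key {i j : Fin N} {a b : M N} (e : s i * a = s j * b) : Kp i j a b :=
  IH_all N (len a + 1) i j a b (by omega) e

theorem s_canc {i : Fin N} {a b : M N} (e : s i * a = s i * b) : a = b :=
  (IH_all N (len a + 1)).canc (by omega) e

theorem left_canc (c : M N) {a b : M N} (e : c * a = c * b) : a = b := by
  induction c using M.ind with
  | h1 => simpa using e
  | h i y ih =>
    rw [mul_assoc, mul_assoc] at e
    exact ih (s_canc e)

/-- reversal -/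
def rev (N : ℕ) : M N →* (M N)ᵐᵒᵖ :=
  PresentedMonoid.lift (fun i => MulOpposite.op (s i)) (by
    intro a b h
    cases h with
    | far i j h =>
      simp only [map_mul, FreeMonoid.lift_eval_of, ← MulOpposite.op_mul, cm0 h]
    | adj i j h =>
      simp only [map_mul, FreeMonoid.lift_eval_of, ← MulOpposite.op_mul, ← mul_assoc, br0 h])

theorem rev_s (i : Fin N) : rev N (s i) = MulOpposite.op (s i) := rfl

theorem rev_rev (x : M N) : (rev N (rev N x).unop).unop = x := by
  induction x using M.ind with
  | h1 => simp
  | h i y ih => simp [rev_s, ih]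

theorem right_canc (c : M N) {a b : M N} (e : a * c = b * c) : a = b := by
  have h := congrArg (fun x => (rev N x).unop) e
  simp only [map_mul, MulOpposite.unop_mul] at h
  have := left_canc _ h
  rw [← rev_rev a, this, rev_rev]

/-- Maximal common divisors are greatest. -/
theorem max_gcd (n : ℕ) : ∀ (p q g d : M N), len p ≤ n → g ∣ p → g ∣ q → d ∣ p → d ∣ q →
    (∀ i, g * s i ∣ p → g * s i ∣ q → False) → d ∣ g := by
  induction n with
  | zero =>
    intro p q g d hp _ _ hdp _ _
    rcases M.cases d with rfl | ⟨i, d', rfl⟩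
    · exact one_dvd _
    · obtain ⟨z, rfl⟩ := hdp
      simp at hp
  | succ n ih =>
    intro p q g d hp hgp hgq hdp hdq hmax
    rcases M.cases d with rfl | ⟨i, d', rfl⟩
    · exact one_dvd _
    rcases M.cases g with rfl | ⟨j, g', rfl⟩
    · exfalso
      refine hmax i ?_ ?_
      · rw [one_mul]; exact (Dvd.intro _ rfl).trans hdp
      · rw [one_mul]; exact (Dvd.intro _ rfl).trans hdq
    have sd : ∀ (k : Fin N) (x y : M N), s k * x ∣ s k * y ↔ x ∣ y := by
      intro k x y
      constructor
      · rintro ⟨z, hz⟩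
        rw [mul_assoc] at hz
        exact ⟨z, s_canc hz⟩
      · exact mul_dvd_mul_left _
    -- stripping a common first letter
    have strip : ∀ (k : Fin N) (g' d' : M N), s k * g' ∣ p → s k * g' ∣ q → s k * d' ∣ p →
        s k * d' ∣ q → (∀ i, s k * g' * s i ∣ p → s k * g' * s i ∣ q → False) → d' ∣ g' := by
      intro k g' d' h1 h2 h3 h4 h5
      obtain ⟨p', rfl⟩ : s k ∣ p := (Dvd.intro _ rfl).trans h1
      obtain ⟨q', rfl⟩ : s k ∣ q := (Dvd.intro _ rfl).trans h2
      rw [sd] at h1 h2 h3 h4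
      refine ih p' q' g' d' (by simp at hp; omega) h1 h2 h3 h4 ?_
      intro i hi hi'
      refine h5 i ?_ ?_
      · rw [mul_assoc, sd]; exact hi
      · rw [mul_assoc, sd]; exact hi'
    have main : s i ∣ s j * g' := by
      obtain ⟨p1, hp1⟩ := hdp
      obtain ⟨p2, hp2⟩ := hgp
      obtain ⟨q1, hq1⟩ := hdq
      obtain ⟨q2, hq2⟩ := hgq
      have ep : s i * (d' * p1) = s j * (g' * p2) := by
        rw [← mul_assoc, ← mul_assoc, ← hp1, ← hp2]
      have eq : s i * (d' * q1) = s j * (g' * q2) := by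
        rw [← mul_assoc, ← mul_assoc, ← hq1, ← hq2]
      have kp := key ep
      have kq := key eq
      rcases trich i j with rfl | hij | hij
      · exact Dvd.intro _ rfl
      · obtain ⟨w, -, hw⟩ := (IH_all N _).far hij (Nat.lt_succ_self _) ep
        obtain ⟨v, -, hv⟩ := (IH_all N _).far hij (Nat.lt_succ_self _) eq
        have : s i ∣ g' := by
          refine strip j g' (s i) ⟨p2, hp2⟩ ⟨q2, hq2⟩ ⟨w, ?_⟩ ⟨v, ?_⟩ hmax
          · rw [hp2, mul_assoc, hw, mul_assoc]
          · rw [hq2, mul_assoc, hv, mul_assoc]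
        obtain ⟨z, rfl⟩ := this
        exact ⟨s j * z, cm hij.symm z⟩
      · obtain ⟨w, -, hw⟩ := (IH_all N _).adj hij (Nat.lt_succ_self _) ep
        obtain ⟨v, -, hv⟩ := (IH_all N _).adj hij (Nat.lt_succ_self _) eq
        have : s i * s j ∣ g' := by
          refine strip j g' (s i * s j) ⟨p2, hp2⟩ ⟨q2, hq2⟩ ⟨w, ?_⟩ ⟨v, ?_⟩ hmax
          · rw [hp2, mul_assoc, hw]; simp only [mul_assoc]
          · rw [hq2, mul_assoc, hv]; simp only [mul_assoc]
        obtain ⟨z, rfl⟩ := this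
        refine ⟨s j * (s i * z), ?_⟩
        rw [mul_assoc, br hij]
    obtain ⟨g'', hg''⟩ := main
    rw [hg''] at hgp hgq hmax ⊢
    rw [sd]
    exact strip i g'' d' hgp hgq hdp hdq hmax

/-! ### The Garside element and common multiples -/

/-- generator with natural index (junk value `1`) -/
def sn (N : ℕ) (i : ℕ) : M N := if h : i < N then s ⟨i, h⟩ else 1

theorem sn_far {i j : ℕ} (h : i + 2 ≤ j) : sn N i * sn N j = sn N j * sn N i := by
  unfold sn
  split_ifs <;> try simp
  exact cm0 (Or.inl h)

theorem sn_adj {i : ℕ} (h : i + 1 < N) :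
    sn N i * sn N (i+1) * sn N i = sn N (i+1) * sn N i * sn N (i+1) := by
  unfold sn
  rw [dif_pos h, dif_pos (by omega)]
  exact br0 (Or.inl rfl)

/-- `σ_0 ⋯ σ_{m-1}` -/
def de (N : ℕ) : ℕ → M N
  | 0 => 1
  | m + 1 => de N m * sn N m

/-- Garside element on `m` strands -/
def De (N : ℕ) : ℕ → M N
  | 0 => 1
  | m + 1 => de N m * De N m

theorem de_far {m j : ℕ} (h : m + 1 ≤ j) : de N m * sn N j = sn N j * de N m := by
  induction m with
  | zero => simp [de]
  | succ m ih =>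
    rw [de, mul_assoc, sn_far (by omega), ← mul_assoc, ih (by omega), mul_assoc]

theorem De_far {m j : ℕ} (h : m ≤ j) : De N m * sn N j = sn N j * De N m := by
  induction m with
  | zero => simp [De]
  | succ m ih =>
    rw [De, mul_assoc, ih (by omega), ← mul_assoc, de_far (by omega), mul_assoc]

theorem de_shift {m i : ℕ} (hm : m ≤ N) (h : i + 1 < m) :
    sn N (i+1) * de N m = de N m * sn N i := by
  induction m with
  | zero => omega
  | succ m ih =>
    rcases Nat.lt_or_ge (i+1) m with h' | h'
    · rw [de, ← mul_assoc, ih (by omega) h', mul_assoc, mul_assoc, sn_far (by omega)]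
    · obtain rfl : m = i + 1 := by omega
      rw [de, de]
      calc sn N (i+1) * (de N i * sn N i * sn N (i+1))
          = (sn N (i+1) * de N i) * sn N i * sn N (i+1) := by simp only [mul_assoc]
        _ = de N i * (sn N (i+1) * sn N i * sn N (i+1)) := by
            rw [← de_far (by omega)]; simp only [mul_assoc]
        _ = _ := by rw [← sn_adj (by omega)]; simp only [mul_assoc]

/-- `σ_0 δ_m δ_k = δ_{k+1} δ_m` for `k < m` -/
theorem de_de {m k : ℕ} (hm : m ≤ N) (h : k < m) :
    sn N 0 * de N m * de N k = de N (k+1) * de N m := by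
  induction k with
  | zero => simp [de]
  | succ k ih =>
    rw [de, ← mul_assoc, ih (by omega), mul_assoc, ← de_shift hm (by omega), ← mul_assoc, ← de]

theorem De_flip {m i : ℕ} (hm : m ≤ N) (h : i < m) :
    sn N (m - 1 - i) * De N (m+1) = De N (m+1) * sn N i := by
  induction m generalizing i with
  | zero => omega
  | succ m ih =>
    rcases Nat.lt_or_ge i m with h' | h'
    · rw [De, mul_assoc, ← ih (by omega) h', ← mul_assoc, ← mul_assoc, ← de_shift hm (by omega)]
      congr 3
      omega
    · obtain rfl : i = m := by omega
      rw [show i + 1 - 1 - i = 0 by omega, De, De]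
      calc sn N 0 * (de N (i+1) * (de N i * De N i))
          = sn N 0 * de N (i+1) * de N i * De N i := by simp only [mul_assoc]
        _ = de N (i+1) * de N (i+1) * De N i := by rw [de_de hm (by omega)]
        _ = de N (i+1) * de N i * (sn N i * De N i) := by
            nth_rewrite 2 [de]; simp only [mul_assoc]
        _ = _ := by rw [← De_far (le_refl i)]; simp only [mul_assoc]

theorem sn0_De {m : ℕ} (h : 0 < m) : ∃ x, De N (m+1) = sn N 0 * x := by
  have : ∃ x, de N m = sn N 0 * x := by
    induction m with
    | zero => omega
    | succ m ih =>
      rcases Nat.eq_zero_or_pos m with rfl | h'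
      · exact ⟨1, by simp [de]⟩
      · obtain ⟨x, hx⟩ := ih h'
        exact ⟨x * sn N m, by rw [de, hx, mul_assoc]⟩
  obtain ⟨x, hx⟩ := this
  exact ⟨x * De N m, by rw [De, hx, mul_assoc]⟩

theorem sn_rdvd_De {m i : ℕ} (hm : m ≤ N) (h : i < m) : ∃ x, De N (m+1) = x * sn N i := by
  induction m with
  | zero => omega
  | succ m ih =>
    rcases Nat.lt_or_ge i m with h' | h'
    · obtain ⟨x, hx⟩ := ih (by omega) h'
      exact ⟨de N (m+1) * x, by rw [De, hx, mul_assoc]⟩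
    · obtain rfl : i = m := by omega
      obtain ⟨x, hx⟩ := sn0_De (N := N) (Nat.succ_pos i)
      have e := De_flip (N := N) hm h
      rw [show i + 1 - 1 - i = 0 by omega] at e
      refine ⟨x, left_canc (sn N 0) ?_⟩
      rw [e, ← mul_assoc, ← hx]

theorem s_rdvd (i : Fin N) : ∃ x, De N (N+1) = x * s i := by
  have := sn_rdvd_De (N := N) le_rfl i.2
  simpa [sn] using this

theorem De_conj (x : M N) : ∃ y, De N (N+1) * x = y * De N (N+1) := by
  induction x using M.ind with
  | h1 => exact ⟨1, by simp⟩
  | h i x ih =>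
    obtain ⟨y, hy⟩ := ih
    have := De_flip (N := N) le_rfl i.2
    rw [show sn N i = s i by simp [sn]] at this
    exact ⟨sn N (N - 1 - i) * y, by rw [← mul_assoc, ← this, mul_assoc, hy, mul_assoc]⟩

theorem rdvd_pow (a : M N) : ∃ k x, De N (N+1) ^ k = x * a := by
  induction a using M.ind with
  | h1 => exact ⟨0, 1, by simp⟩
  | h i a ih =>
    obtain ⟨k, x, hx⟩ := ih
    obtain ⟨y, hy⟩ := De_conj x
    obtain ⟨z, hz⟩ := s_rdvd i
    refine ⟨k+1, y * z, ?_⟩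
    rw [pow_succ', hx, ← mul_assoc, hy]
    nth_rewrite 1 [hz]
    simp only [mul_assoc]

theorem common_mult (a b : M N) : ∃ x y, x * a = y * b := by
  obtain ⟨k, x, hx⟩ := rdvd_pow a
  obtain ⟨l, y, hy⟩ := rdvd_pow b
  refine ⟨De N (N+1) ^ l * x, De N (N+1) ^ k * y, ?_⟩
  rw [mul_assoc, mul_assoc, ← hx, ← hy, ← pow_add, ← pow_add, add_comm l k]

/-- The Ore structure. -/
noncomputable instance oreTop : OreLocalization.OreSet (⊤ : Submonoid (M N)) where
  ore_right_cancel r₁ r₂ t h := ⟨1, by rw [right_canc _ h]⟩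
  oreNum r t := (common_mult r (t : M N)).choose_spec.choose
  oreDenom r t := ⟨(common_mult r (t : M N)).choose, trivial⟩
  ore_eq r t := (common_mult r (t : M N)).choose_spec.choose_spec

/-- The fraction monoid. -/
abbrev Loc (N : ℕ) := OreLocalization (⊤ : Submonoid (M N)) (M N)

theorem num_inj {a b : M N}
    (h : (OreLocalization.numeratorHom a : Loc N) = OreLocalization.numeratorHom b) : a = b := by
  rw [OreLocalization.numeratorHom_apply, OreLocalization.numeratorHom_apply,
    OreLocalization.oreDiv_eq_iff] at h
  obtain ⟨u, v, h1, h2⟩ := h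
  replace h2 : (u : M N) = v := by simpa using h2
  rw [← h2] at h1
  exact (left_canc (u : M N) h1).symm

/-- generator as a unit of the fraction monoid -/
noncomputable def su (i : Fin N) : (Loc N)ˣ := OreLocalization.numeratorUnit ⟨s i, trivial⟩

theorem su_val (i : Fin N) : ((su i : (Loc N)ˣ) : Loc N) = OreLocalization.numeratorHom (s i) := rfl

end PBM

theorem braid_far {n : ℕ} {i j : Fin (n-1)} (h : (i : ℕ) + 2 ≤ j) :
    (braidGen i * braidGen j : BraidGroup n) = braidGen j * braidGen i := by
  have := PresentedGroup.one_of_mem (rels := braidRels n) (Or.inl ⟨i, j, h, rfl⟩)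
  rw [map_mul, map_inv, mul_inv_eq_one, map_mul, map_mul] at this
  exact this

theorem braid_adj {n : ℕ} {i j : Fin (n-1)} (h : (i : ℕ) + 1 = j) :
    (braidGen i * braidGen j * braidGen i : BraidGroup n) =
      braidGen j * braidGen i * braidGen j := by
  have := PresentedGroup.one_of_mem (rels := braidRels n) (Or.inr ⟨i, j, h, rfl⟩)
  rw [map_mul, map_inv, mul_inv_eq_one] at this
  simp only [map_mul] at this
  exact this

/-- From the abstract monoid to the braid group. -/
def toB (n : ℕ) : PBM.M (n-1) →* BraidGroup n :=
  PresentedMonoid.lift (fun i => braidGen i) (by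
    intro a b h
    cases h with
    | far i j h =>
      simp only [map_mul, FreeMonoid.lift_eval_of]
      rcases h with h | h
      · exact braid_far h
      · exact (braid_far h).symm
    | adj i j h =>
      simp only [map_mul, FreeMonoid.lift_eval_of]
      rcases h with h | h
      · exact braid_adj h
      · exact (braid_adj h).symm)

theorem toB_s {n : ℕ} (i : Fin (n-1)) : toB n (PBM.s i) = braidGen i := rfl

/-- From the braid group to the fraction group. -/
noncomputable def fromB (n : ℕ) : BraidGroup n →* (PBM.Loc (n-1))ˣ :=
  PresentedGroup.toGroup (rels := braidRels n) (f := PBM.su) (by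
    rintro r (⟨i, j, h, rfl⟩ | ⟨i, j, h, rfl⟩)
    · rw [map_mul, map_inv, mul_inv_eq_one]
      simp only [map_mul, FreeGroup.lift_apply_of]
      ext
      simp only [Units.val_mul, PBM.su_val, ← map_mul]
      rw [PBM.cm0 (Or.inl h)]
    · rw [map_mul, map_inv, mul_inv_eq_one]
      simp only [map_mul, FreeGroup.lift_apply_of]
      ext
      simp only [Units.val_mul, PBM.su_val, ← map_mul]
      rw [PBM.br0 (Or.inl h)])

theorem fromB_gen {n : ℕ} (i : Fin (n-1)) : fromB n (braidGen i) = PBM.su i :=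
  PresentedGroup.toGroup.of _

theorem fromB_toB {n : ℕ} (x : PBM.M (n-1)) :
    ((fromB n (toB n x) : (PBM.Loc (n-1))ˣ) : PBM.Loc (n-1)) =
      OreLocalization.numeratorHom x := by
  induction x using PBM.M.ind with
  | h1 => rw [map_one, map_one, map_one]; rfl
  | h i x ih =>
    rw [map_mul, map_mul, map_mul, Units.val_mul, ih, toB_s, fromB_gen, PBM.su_val]

theorem toB_inj {n : ℕ} {x y : PBM.M (n-1)} (h : toB n x = toB n y) : x = y := by
  apply PBM.num_inj
  rw [← fromB_toB, ← fromB_toB, h]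

theorem toB_mem {n : ℕ} (x : PBM.M (n-1)) : toB n x ∈ PosBraid n := by
  induction x using PBM.M.ind with
  | h1 => rw [map_one]; exact one_mem _
  | h i x ih =>
    rw [map_mul, toB_s]
    exact mul_mem (Submonoid.subset_closure ⟨i, rfl⟩) ih

theorem mem_toB {n : ℕ} {x : BraidGroup n} (h : x ∈ PosBraid n) : ∃ y, toB n y = x := by
  have : PosBraid n ≤ MonoidHom.mrange (toB n) := by
    refine Submonoid.closure_le.2 ?_
    rintro _ ⟨i, rfl⟩
    exact ⟨PBM.s i, rfl⟩
  exact this h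

theorem divL_iff {n : ℕ} (x y : PBM.M (n-1)) : DividesL (toB n x) (toB n y) ↔ x ∣ y := by
  constructor
  · rintro ⟨z, hz, e⟩
    obtain ⟨z, rfl⟩ := mem_toB hz
    rw [← map_mul] at e
    exact ⟨z, toB_inj e⟩
  · rintro ⟨z, rfl⟩
    exact ⟨toB n z, toB_mem z, map_mul _ _ _⟩

/-- For simple braids `s, t` : `(s, t)` is normal iff `gcd_L(s*, t) = 1`, where
`s*` is the unique simple braid with `s·s* = Δ_n`. -/
theorem normal_iff_coprime_dual (n : ℕ) (s t sStar : BraidGroup n)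
    (hs : Simple s) (ht : Simple t) (hStar : Simple sStar)
    (hdual : s * sStar = braidDelta n) :
    GNormal s t ↔
      ∀ d ∈ PosBraid n, DividesL d sStar → DividesL d t → d = 1 := by
  obtain ⟨s, rfl⟩ := mem_toB hs.1
  obtain ⟨t, rfl⟩ := mem_toB ht.1
  obtain ⟨u, rfl⟩ := mem_toB hStar.1
  unfold GNormal IsLeftGcd
  rw [← hdual, ← map_mul, ← map_mul]
  constructor
  · rintro ⟨-, -, -, h⟩ d hd h1 h2
    obtain ⟨d, rfl⟩ := mem_toB hd
    rw [divL_iff] at h1 h2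
    have := h (toB n (s * d)) (toB_mem _)
      ((divL_iff _ _).2 (mul_dvd_mul_left s h2)) ((divL_iff _ _).2 (mul_dvd_mul_left s h1))
    rw [divL_iff] at this
    obtain ⟨z, hz⟩ := this
    have hl := congrArg PBM.len hz
    simp only [PBM.len_mul] at hl
    rcases PBM.M.cases d with rfl | ⟨i, y, rfl⟩
    · exact map_one _
    · simp only [PBM.len_mul, PBM.len_s] at hl
      omega
  · intro h
    refine ⟨toB_mem _, (divL_iff _ _).2 (Dvd.intro _ rfl), (divL_iff _ _).2 (Dvd.intro _ rfl), ?_⟩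
    intro d hd h1 h2
    obtain ⟨d, rfl⟩ := mem_toB hd
    rw [divL_iff] at h1 h2 ⊢
    refine PBM.max_gcd _ (s * t) (s * u) s d le_rfl (Dvd.intro _ rfl) (Dvd.intro _ rfl) h1 h2 ?_
    rintro i ⟨z, hz⟩ ⟨w, hw⟩
    rw [mul_assoc] at hz hw
    have h3 := h (toB n (PBM.s i)) (toB_mem _)
      ((divL_iff _ _).2 ⟨w, PBM.left_canc s hw⟩) ((divL_iff _ _).2 ⟨z, PBM.left_canc s hz⟩)
    rw [← map_one (toB n)] at h3
    have := congrArg PBM.len (toB_inj h3)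
    simp at this
end
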